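/- Let σ ∈ (1/2, 1) be fixed. Set ϑ(σ) = min( 3(1−σ)/(2−σ), 2(1−σ)/σ ) and λ(σ) = ∫₀¹ t^{σ}/(2 − t^{σ}) dt. Then for every constant c with 0 < c < (σ/(1−σ)) · ( (1 − ϑ(σ)) / (σ(1 + λ(σ))) )^{1−σ}, for all sufficiently large prime numbers q there is a non-principal Dirichlet character χ modulo q with L(σ, χ) ≠ 0 and −Re( L′(σ, χ)/L(σ, χ) ) ≥ c · (log q)^{1−σ} (log log q)^{1−σ}. -/

import Mathlib

open Filter Topology MeasureTheory Set

namespace WienerIkehara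

/-- The Fejér kernel, as the cosine transform of the tent function. -/
noncomputable def fejer (w : ℝ) : ℝ := ∫ t in (0:ℝ)..1, 2 * (1 - t) * Real.cos (t * w)

lemma fejer_eq {w : ℝ} (hw : w ≠ 0) : fejer w = 2 * (1 - Real.cos w) / w ^ 2 := by
  have h : ∀ t ∈ uIcc (0:ℝ) 1, HasDerivAt
      (fun t : ℝ ↦ 2 * ((1 - t) * Real.sin (t * w) / w - Real.cos (t * w) / w ^ 2))
      (2 * (1 - t) * Real.cos (t * w)) t := by
    intro t _
    have h0 : HasDerivAt (fun t : ℝ ↦ t * w) w t := by simpa using (hasDerivAt_id t).mul_const w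
    have h1 : HasDerivAt (fun t : ℝ ↦ 1 - t) (-1) t := by
      simpa using (hasDerivAt_id t).const_sub 1
    have := (((h1.mul h0.sin).div_const w).sub (h0.cos.div_const (w ^ 2))).const_mul 2
    refine this.congr_deriv ?_
    field_simp
    ring
  rw [fejer, intervalIntegral.integral_eq_sub_of_hasDerivAt h
    (Continuous.intervalIntegrable (by fun_prop) _ _)]
  simp
  ring

lemma fejer_zero : fejer 0 = 1 := by
  have h : ∀ t ∈ uIcc (0:ℝ) 1, HasDerivAt (fun t : ℝ ↦ 2 * t - t ^ 2) (2 * (1 - t)) t := by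
    intro t _
    refine (((hasDerivAt_id t).const_mul 2).sub (hasDerivAt_pow 2 t)).congr_deriv ?_
    simp; ring
  have := intervalIntegral.integral_eq_sub_of_hasDerivAt h
    (Continuous.intervalIntegrable (by fun_prop) _ _)
  simp only [fejer, mul_zero, Real.cos_zero, mul_one]
  rw [this]; norm_num

lemma fejer_nonneg (w : ℝ) : 0 ≤ fejer w := by
  rcases eq_or_ne w 0 with rfl | hw
  · simp [fejer_zero]
  · rw [fejer_eq hw]
    have := Real.cos_le_one w
    exact div_nonneg (by linarith) (sq_nonneg w)

lemma continuous_fejer : Continuous fejer := by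
  unfold fejer
  exact intervalIntegral.continuous_parametric_intervalIntegral_of_continuous' (by fun_prop) 0 1

lemma fejer_le_one (w : ℝ) : fejer w ≤ 1 := by
  rw [← fejer_zero, fejer, fejer]
  refine intervalIntegral.integral_mono_on (by norm_num)
    (Continuous.intervalIntegrable (by fun_prop) _ _)
    (Continuous.intervalIntegrable (by fun_prop) _ _) fun t ht ↦ ?_
  simp only [mul_zero, Real.cos_zero]
  exact mul_le_mul_of_nonneg_left (Real.cos_le_one _) (by linarith [ht.2])

lemma fejer_le (w : ℝ) : fejer w ≤ 5 * (1 + w ^ 2)⁻¹ := by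
  have hp : 0 < 1 + w ^ 2 := by positivity
  rw [← div_eq_mul_inv, le_div_iff₀ hp]
  rcases eq_or_ne w 0 with rfl | hw
  · simp [fejer_zero]
  · have h2 : fejer w * w ^ 2 ≤ 4 := by
      rw [fejer_eq hw, div_mul_cancel₀ _ (pow_ne_zero 2 hw)]
      linarith [Real.neg_one_le_cos w]
    linarith [fejer_le_one w]

lemma integrable_fejer : Integrable fejer :=
  (integrable_inv_one_add_sq.const_mul 5).mono' continuous_fejer.aestronglyMeasurable
    (ae_of_all _ fun w ↦ by
      rw [Real.norm_of_nonneg (fejer_nonneg w)]; exact fejer_le w)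

lemma integral_fejer_pos : 0 < ∫ w, fejer w :=
  integral_pos_of_integrable_nonneg_nonzero continuous_fejer integrable_fejer fejer_nonneg
    (x := 0) (by simp [fejer_zero])

/-- Fubini for the Laplace transform of a bounded function against the Fejér kernel. -/
lemma integral_tent_mul_laplace {h : ℝ → ℝ} (hm : Measurable h) {M : ℝ} (hM : ∀ u, |h u| ≤ M)
    {ε : ℝ} (hε : 0 < ε) (T y : ℝ) :
    ∫ t in (0:ℝ)..1, 2 * (1 - t) * (Complex.exp (T * y * t * Complex.I) *
      ∫ u in Ioi (0:ℝ), h u * Complex.exp (-(ε + T * t * Complex.I) * u)).re =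
    ∫ u in Ioi (0:ℝ), h u * Real.exp (-ε * u) * fejer (T * (y - u)) := by
  have hexp : IntegrableOn (fun u : ℝ ↦ M * Real.exp (-ε * u)) (Ioi 0) :=
    (integrableOn_exp_mul_Ioi (by linarith) 0).const_mul M
  have hintegrable : ∀ t : ℝ, Integrable (fun u : ℝ ↦ (h u : ℂ) *
      Complex.exp (-(ε + T * t * Complex.I) * u)) (volume.restrict (Ioi 0)) := by
    intro t
    refine hexp.mono' (by fun_prop) (ae_of_all _ fun u ↦ ?_)
    rw [norm_mul, Complex.norm_real, Complex.norm_exp]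
    simp only [Real.norm_eq_abs]
    have : (-((ε:ℂ) + T * t * Complex.I) * u).re = -ε * u := by simp
    rw [this]
    exact mul_le_mul_of_nonneg_right (hM u) (Real.exp_pos _).le
  have key : ∀ t : ℝ, 2 * (1 - t) * (Complex.exp (T * y * t * Complex.I) *
      ∫ u in Ioi (0:ℝ), h u * Complex.exp (-(ε + T * t * Complex.I) * u)).re =
      ∫ u in Ioi (0:ℝ), h u * Real.exp (-ε * u) *
        (2 * (1 - t) * Real.cos (t * (T * (y - u)))) := by
    intro t
    rw [← integral_const_mul]
    have := integral_re ((hintegrable t).const_mul (Complex.exp (T * y * t * Complex.I)))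
    simp only [RCLike.re_eq_complex_re] at this
    rw [← this, ← integral_const_mul]
    refine integral_congr_ae (ae_of_all _ fun u ↦ ?_)
    have : Complex.exp (T * y * t * Complex.I) * (h u * Complex.exp (-(ε + T * t * Complex.I) * u))
        = ((h u * Real.exp (-ε * u) : ℝ) : ℂ) *
          Complex.exp ((t * (T * (y - u)) : ℝ) * Complex.I) := by
      push_cast
      rw [mul_left_comm, ← Complex.exp_add, mul_assoc (h u : ℂ), ← Complex.exp_add]
      congr 2; ring
    simp only []
    rw [this, Complex.re_ofReal_mul, Complex.exp_ofReal_mul_I_re]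
    ring
  simp_rw [key]
  rw [intervalIntegral.integral_of_le zero_le_one, integral_integral_swap]
  · refine integral_congr_ae (ae_of_all _ fun u ↦ ?_)
    simp only [fejer]
    rw [intervalIntegral.integral_of_le zero_le_one, ← integral_const_mul]
  · have h2 : Integrable (fun _ : ℝ ↦ (2:ℝ)) (volume.restrict (Ioc 0 1)) := integrable_const _
    refine (h2.mul_prod hexp).mono' (by fun_prop) ?_
    have hae : ∀ᵐ z ∂((volume.restrict (Ioc (0:ℝ) 1)).prod (volume.restrict (Ioi (0:ℝ)))),
        z.1 ∈ Ioc (0:ℝ) 1 := by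
      rw [Measure.prod_restrict]
      filter_upwards [ae_restrict_mem (measurableSet_Ioc.prod measurableSet_Ioi)] with z hz
      exact hz.1
    filter_upwards [hae] with z hz
    simp only [Function.uncurry, norm_mul, Real.norm_eq_abs, Real.abs_exp]
    have h1 : |h z.2| * Real.exp (-ε * z.2) ≤ M * Real.exp (-ε * z.2) :=
      mul_le_mul_of_nonneg_right (hM _) (Real.exp_pos _).le
    have h3 : |(2:ℝ)| * |1 - z.1| * |Real.cos (z.1 * (T * (y - z.2)))| ≤ 2 := by
      have := Real.abs_cos_le_one (z.1 * (T * (y - z.2)))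
      have h4 : |1 - z.1| ≤ 1 := abs_le.2 ⟨by linarith [hz.2], by linarith [hz.1]⟩
      rw [abs_two]
      have := mul_le_mul h4 this (abs_nonneg _) zero_le_one
      nlinarith
    rw [mul_comm (2:ℝ)]
    exact mul_le_mul h1 h3 (by positivity) ((by positivity : (0:ℝ) ≤ _).trans h1)

/-- The limiting form of `integral_tent_mul_laplace` when the Laplace transform extends
continuously to the imaginary axis. -/
lemma integral_mul_fejer_eq {h : ℝ → ℝ} (hm : Measurable h) {M : ℝ} (hM : ∀ u, |h u| ≤ M)
    {g : ℂ → ℂ} (hg : Continuous g)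
    (hlap : ∀ ε : ℝ, 0 < ε → ∀ t : ℝ,
      ∫ u in Ioi (0:ℝ), h u * Complex.exp (-(ε + t * Complex.I) * u) = g (ε + t * Complex.I))
    {T : ℝ} (hT : 0 < T) (y : ℝ) :
    ∫ u in Ioi (0:ℝ), h u * fejer (T * (y - u)) =
      ∫ t in (0:ℝ)..1, 2 * (1 - t) *
        (Complex.exp (T * y * t * Complex.I) * g (T * t * Complex.I)).re := by
  have hkint : Integrable (fun u ↦ fejer (T * (y - u))) := by
    have := (integrable_fejer.comp_mul_left' hT.ne').comp_sub_left y
    exact this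
  have hL : Tendsto (fun ε : ℝ ↦ ∫ t in (0:ℝ)..1, 2 * (1 - t) *
      (Complex.exp (T * y * t * Complex.I) * g (ε + T * t * Complex.I)).re) (𝓝[>] 0)
      (𝓝 (∫ t in (0:ℝ)..1, 2 * (1 - t) *
        (Complex.exp (T * y * t * Complex.I) * g (T * t * Complex.I)).re)) := by
    have hc : Continuous fun ε : ℝ ↦ ∫ t in (0:ℝ)..1, 2 * (1 - t) *
        (Complex.exp (T * y * t * Complex.I) * g (ε + T * t * Complex.I)).re := by
      apply intervalIntegral.continuous_parametric_intervalIntegral_of_continuous'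
      have h1 : Continuous fun p : ℝ × ℝ ↦
        (Complex.exp (T * y * p.2 * Complex.I) * g (p.1 + T * p.2 * Complex.I)).re := by
        refine Complex.continuous_re.comp (Continuous.mul (by fun_prop) (hg.comp (by fun_prop)))
      exact (by fun_prop : Continuous fun p : ℝ × ℝ ↦ 2 * (1 - p.2)).mul h1
    have := (hc.tendsto 0).mono_left (nhdsWithin_le_nhds (s := Ioi 0))
    simpa using this
  have hR : Tendsto (fun ε : ℝ ↦ ∫ u in Ioi (0:ℝ), h u * Real.exp (-ε * u) * fejer (T * (y - u)))
      (𝓝[>] 0) (𝓝 (∫ u in Ioi (0:ℝ), h u * fejer (T * (y - u)))) := by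
    refine tendsto_integral_filter_of_dominated_convergence (fun u ↦ M * fejer (T * (y - u)))
      (Eventually.of_forall fun ε ↦ ?_) ?_ (hkint.integrableOn.const_mul M) ?_
    · have := continuous_fejer.measurable
      exact Measurable.aestronglyMeasurable (by fun_prop)
    · filter_upwards [self_mem_nhdsWithin] with ε hε
      filter_upwards [ae_restrict_mem measurableSet_Ioi] with u hu
      simp only [mem_Ioi] at hε hu
      have h1 : Real.exp (-ε * u) ≤ 1 := Real.exp_le_one_iff.2 (by nlinarith)
      rw [norm_mul, norm_mul, Real.norm_of_nonneg (fejer_nonneg _), Real.norm_eq_abs,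
        Real.norm_of_nonneg (Real.exp_pos _).le]
      refine mul_le_mul_of_nonneg_right ?_ (fejer_nonneg _)
      calc |h u| * Real.exp (-ε * u) ≤ |h u| * 1 :=
            mul_le_mul_of_nonneg_left h1 (abs_nonneg _)
        _ ≤ M := by simpa using hM u
    · refine ae_of_all _ fun u ↦ ?_
      have hc : Continuous fun ε : ℝ ↦ h u * Real.exp (-ε * u) * fejer (T * (y - u)) := by
        fun_prop
      have := (hc.tendsto 0).mono_left (nhdsWithin_le_nhds (s := Ioi 0))
      simpa using this
  refine tendsto_nhds_unique hR (hL.congr' ?_)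
  filter_upwards [self_mem_nhdsWithin] with ε hε
  rw [← integral_tent_mul_laplace hm hM hε T y]
  refine intervalIntegral.integral_congr fun t _ ↦ ?_
  have := hlap ε hε (T * t)
  push_cast at this
  simp only [this]

lemma tendsto_integral_mul_fejer {h : ℝ → ℝ} (hm : Measurable h) {M : ℝ} (hM : ∀ u, |h u| ≤ M)
    {g : ℂ → ℂ} (hg : Continuous g)
    (hlap : ∀ ε : ℝ, 0 < ε → ∀ t : ℝ,
      ∫ u in Ioi (0:ℝ), h u * Complex.exp (-(ε + t * Complex.I) * u) = g (ε + t * Complex.I))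
    {T : ℝ} (hT : 0 < T) :
    Tendsto (fun y ↦ ∫ u in Ioi (0:ℝ), h u * fejer (T * (y - u))) atTop (𝓝 0) := by
  simp_rw [integral_mul_fejer_eq hm hM hg hlap hT]
  set f : ℝ → ℂ := (Ioc (0:ℝ) 1).indicator fun t ↦ 2 * (1 - t) * g (T * t * Complex.I) with hf
  have hRL := Real.tendsto_integral_exp_smul_cocompact f
  have hw : Tendsto (fun y : ℝ ↦ -(T * y / (2 * Real.pi))) atTop (cocompact ℝ) := by
    refine Tendsto.mono_right ?_ atBot_le_cocompact
    refine tendsto_neg_atTop_atBot.comp ?_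
    have : Tendsto (fun y : ℝ ↦ (T / (2 * Real.pi)) * y) atTop atTop :=
      tendsto_id.const_mul_atTop (by positivity)
    exact this.congr fun y ↦ by ring
  have h2 := (Complex.continuous_re.tendsto _).comp (hRL.comp hw)
  rw [Complex.zero_re] at h2
  refine h2.congr fun y ↦ ?_
  simp only [Function.comp]
  have hci : Continuous fun t : ℝ ↦
      Complex.exp (T * y * t * Complex.I) * (2 * (1 - t) * g (T * t * Complex.I)) := by
    exact Continuous.mul (by fun_prop) (Continuous.mul (by fun_prop) (hg.comp (by fun_prop)))
  have h3 : ∀ v : ℝ, (Real.fourierChar (-(v * -(T * y / (2 * Real.pi)))) : Circle) • f v =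
      (Ioc (0:ℝ) 1).indicator (fun t : ℝ ↦
        Complex.exp (T * y * t * Complex.I) * (2 * (1 - t) * g (T * t * Complex.I))) v := by
    intro v
    rw [Circle.smul_def, Real.fourierChar_apply, smul_eq_mul, hf]
    by_cases hv : v ∈ Ioc (0:ℝ) 1
    · simp only [indicator_of_mem hv]
      congr 2
      push_cast
      field_simp
    · simp only [indicator_of_notMem hv, mul_zero]
  simp_rw [h3]
  rw [integral_indicator measurableSet_Ioc, intervalIntegral.integral_of_le zero_le_one]
  have := integral_re (hci.integrableOn_Ioc (a := 0) (b := 1) (μ := volume))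
  simp only [RCLike.re_eq_complex_re] at this
  rw [← this]
  refine integral_congr_ae (ae_of_all _ fun t ↦ ?_)
  have : Complex.exp (T * y * t * Complex.I) * (2 * (1 - t) * g (T * t * Complex.I)) =
    ((2 * (1 - t) : ℝ) : ℂ) * (Complex.exp (T * y * t * Complex.I) * g (T * t * Complex.I)) := by
    push_cast; ring
  simp only []
  rw [this, Complex.re_ofReal_mul]

/-- Tauberian step: a bounded function which cannot decrease fast, and whose averages against
all rescaled Fejér kernels tend to `1`, tends to `1`. -/
lemma tendsto_one_of_fejer_average {B : ℝ → ℝ} (hm : Measurable B) {M : ℝ}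
    (hB0 : ∀ u, 0 ≤ B u) (hBM : ∀ u, B u ≤ M)
    (hslow : ∀ u v, u ≤ v → Real.exp (u - v) * B u ≤ B v)
    (havg : ∀ T : ℝ, 0 < T →
      Tendsto (fun y ↦ ∫ w, B (y - w / T) * fejer w) atTop (𝓝 (∫ w, fejer w))) :
    Tendsto B atTop (𝓝 1) := by
  set c := ∫ w, fejer w with hc
  have hcpos : 0 < c := integral_fejer_pos
  have hM : 0 ≤ M := (hB0 0).trans (hBM 0)
  have hintegrable : ∀ T y, Integrable fun w ↦ B (y - w / T) * fejer w := by
    intro T y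
    refine (integrable_fejer.const_mul M).mono' ?_ (ae_of_all _ fun w ↦ ?_)
    · have := continuous_fejer.measurable
      exact Measurable.aestronglyMeasurable (by fun_prop)
    · rw [norm_mul, Real.norm_of_nonneg (fejer_nonneg _), Real.norm_of_nonneg (hB0 _)]
      exact mul_le_mul_of_nonneg_right (hBM _) (fejer_nonneg _)
  have htail : Tendsto (fun R : ℝ ↦ ∫ w in (-R)..R, fejer w) atTop (𝓝 c) :=
    intervalIntegral_tendsto_integral integrable_fejer tendsto_neg_atTop_atBot tendsto_id
  have hsub : ∀ R : ℝ, 0 < R → ∀ f : ℝ → ℝ,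
      ∫ w in (-R)..R, f w = ∫ w, (Ioc (-R) R).indicator f w := fun R hR f ↦ by
    rw [intervalIntegral.integral_of_le (by linarith), integral_indicator measurableSet_Ioc]
  have upper : ∀ δ : ℝ, 0 < δ → ∀ T : ℝ, 0 < T → ∀ y, Real.exp (-(2 * δ)) * B y *
      (∫ w in (-(T * δ))..(T * δ), fejer w) ≤ ∫ w, B (y + δ - w / T) * fejer w := by
    intro δ hδ T hT y
    rw [hsub _ (by positivity), ← integral_const_mul]
    refine integral_mono ((integrable_fejer.indicator measurableSet_Ioc).const_mul _)
      (hintegrable T (y + δ)) fun w ↦ ?_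
    by_cases hw : w ∈ Ioc (-(T * δ)) (T * δ)
    · simp only [indicator_of_mem hw]
      refine mul_le_mul_of_nonneg_right ?_ (fejer_nonneg _)
      have h1 : w / T ≤ δ := by rw [div_le_iff₀ hT]; linarith [hw.2]
      have h2 : -δ ≤ w / T := by rw [le_div_iff₀ hT]; linarith [hw.1]
      refine le_trans ?_ (hslow y (y + δ - w / T) (by linarith))
      exact mul_le_mul_of_nonneg_right (Real.exp_le_exp.2 (by linarith)) (hB0 _)
    · simp only [indicator_of_notMem hw, mul_zero]
      exact mul_nonneg (hB0 _) (fejer_nonneg _)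
  have lower : ∀ δ : ℝ, 0 < δ → ∀ T : ℝ, 0 < T → ∀ y, ∫ w, B (y - δ - w / T) * fejer w ≤
      Real.exp (2 * δ) * B y * c + M * (c - ∫ w in (-(T * δ))..(T * δ), fejer w) := by
    intro δ hδ T hT y
    have hi : Integrable fun w ↦ M * (fejer w - (Ioc (-(T * δ)) (T * δ)).indicator fejer w) :=
      (integrable_fejer.sub (integrable_fejer.indicator measurableSet_Ioc)).const_mul M
    rw [hsub _ (by positivity), hc, ← integral_const_mul, ← integral_sub integrable_fejer
      (integrable_fejer.indicator measurableSet_Ioc), ← integral_const_mul, ← integral_add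
      (integrable_fejer.const_mul _) hi]
    refine integral_mono (hintegrable T (y - δ)) ((integrable_fejer.const_mul _).add hi) fun w ↦ ?_
    by_cases hw : w ∈ Ioc (-(T * δ)) (T * δ)
    · simp only [indicator_of_mem hw, sub_self, mul_zero, add_zero]
      refine mul_le_mul_of_nonneg_right ?_ (fejer_nonneg _)
      have h1 : w / T ≤ δ := by rw [div_le_iff₀ hT]; linarith [hw.2]
      have h2 : -δ ≤ w / T := by rw [le_div_iff₀ hT]; linarith [hw.1]
      have h3 := hslow (y - δ - w / T) y (by linarith)
      have h4 : Real.exp (-(2 * δ)) * B (y - δ - w / T) ≤ B y :=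
        (mul_le_mul_of_nonneg_right (Real.exp_le_exp.2 (by linarith)) (hB0 _)).trans h3
      have h5 := mul_le_mul_of_nonneg_left h4 (Real.exp_pos (2 * δ)).le
      rwa [← mul_assoc, ← Real.exp_add, add_neg_cancel, Real.exp_zero, one_mul] at h5
    · simp only [indicator_of_notMem hw, sub_zero]
      have h1 := mul_le_mul_of_nonneg_right (hBM (y - δ - w / T)) (fejer_nonneg w)
      have h2 : 0 ≤ Real.exp (2 * δ) * B y * fejer w :=
        mul_nonneg (mul_nonneg (Real.exp_pos _).le (hB0 _)) (fejer_nonneg _)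
      linarith
  have hexp : Tendsto (fun δ : ℝ ↦ Real.exp (2 * δ)) (𝓝[>] 0) (𝓝 1) := by
    have : Continuous fun δ : ℝ ↦ Real.exp (2 * δ) := by fun_prop
    simpa using (this.tendsto 0).mono_left (nhdsWithin_le_nhds (s := Ioi 0))
  have hexp' : Tendsto (fun δ : ℝ ↦ Real.exp (-(2 * δ))) (𝓝[>] 0) (𝓝 1) := by
    have : Continuous fun δ : ℝ ↦ Real.exp (-(2 * δ)) := by fun_prop
    simpa using (this.tendsto 0).mono_left (nhdsWithin_le_nhds (s := Ioi 0))
  have hscale : ∀ δ : ℝ, 0 < δ →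
      Tendsto (fun T : ℝ ↦ ∫ w in (-(T * δ))..(T * δ), fejer w) atTop (𝓝 c) := fun δ hδ ↦
    htail.comp (tendsto_id.atTop_mul_const hδ)
  refine tendsto_order.2 ⟨fun a ha ↦ ?_, fun a ha ↦ ?_⟩
  · obtain ⟨δ, hδa, hδ⟩ := (((hexp.mul_const a).eventually_lt_const
      (by rw [one_mul]; exact ha)).and self_mem_nhdsWithin).exists
    have hδ : 0 < δ := hδ
    have h1 : Tendsto (fun T : ℝ ↦ Real.exp (2 * δ) * a * c +
        M * (c - ∫ w in (-(T * δ))..(T * δ), fejer w)) atTop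
        (𝓝 (Real.exp (2 * δ) * a * c + M * (c - c))) :=
      tendsto_const_nhds.add (((hscale δ hδ).const_sub c).const_mul M)
    have h2 : Real.exp (2 * δ) * a * c + M * (c - c) < c := by
      have := mul_lt_mul_of_pos_right hδa hcpos
      linarith
    obtain ⟨T, hTc, hT⟩ := ((h1.eventually_lt_const h2).and (eventually_gt_atTop 0)).exists
    have h3 := ((havg T hT).comp (tendsto_atTop_add_const_right atTop (-δ) tendsto_id)
      ).eventually_const_lt hTc
    filter_upwards [h3] with y hy
    have := lower δ hδ T hT y
    simp only [Function.comp, id, ← sub_eq_add_neg] at hy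
    have h4 := hy.trans_le this
    have h5 : Real.exp (2 * δ) * c * a < Real.exp (2 * δ) * c * B y := by linarith
    exact lt_of_mul_lt_mul_left h5 (by positivity)
  · obtain ⟨δ, hδa, hδ⟩ := (((hexp'.mul_const a).eventually_const_lt
      (by rw [one_mul]; exact ha)).and self_mem_nhdsWithin).exists
    have hδ : 0 < δ := hδ
    have h1 := (hscale δ hδ).const_mul (Real.exp (-(2 * δ)) * a)
    have h2 : c < Real.exp (-(2 * δ)) * a * c := by
      have := mul_lt_mul_of_pos_right hδa hcpos
      linarith
    obtain ⟨T, ⟨hTc, hT⟩, hI⟩ := (((h1.eventually_const_lt h2).and (eventually_gt_atTop 0)).and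
      ((hscale δ hδ).eventually_const_lt hcpos)).exists
    have h3 := ((havg T hT).comp (tendsto_atTop_add_const_right atTop δ tendsto_id)
      ).eventually_lt_const hTc
    filter_upwards [h3] with y hy
    have h4 := (upper δ hδ T hT y).trans_lt hy
    have h5 : Real.exp (-(2 * δ)) * (∫ w in (-(T * δ))..(T * δ), fejer w) * B y <
      Real.exp (-(2 * δ)) * (∫ w in (-(T * δ))..(T * δ), fejer w) * a := by linarith
    exact lt_of_mul_lt_mul_left h5 (by positivity)

end WienerIkehara

open ArithmeticFunction in
/-- The Laplace transform of `ψ(e^u)e^{-u} - 1` extends continuously to the imaginary axis. -/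
lemma exists_continuous_laplace_psi :
    ∃ g : ℂ → ℂ, Continuous g ∧ ∀ ε : ℝ, 0 < ε → ∀ t : ℝ,
      ∫ u in Ioi (0:ℝ), ((Chebyshev.psi (Real.exp u) * Real.exp (-u) - 1 : ℝ) : ℂ) *
        Complex.exp (-(ε + t * Complex.I) * u) = g (ε + t * Complex.I) := by
  set g₀ : ℂ → ℂ := vonMangoldt.LFunctionResidueClassAux (1 : ZMod 1)
  have hg₀ : ContinuousOn g₀ {s | 1 ≤ s.re} := vonMangoldt.continuousOn_LFunctionResidueClassAux 1
  set P : ℂ → ℂ := fun s ↦ ((max s.re 0 : ℝ) : ℂ) + s.im * Complex.I with hP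
  have hPc : Continuous P := by fun_prop
  have hPre : ∀ s, (P s).re = max s.re 0 := fun s ↦ by simp [hP]
  have hPid : ∀ s : ℂ, 0 ≤ s.re → P s = s := fun s hs ↦ by
    simp only [hP, max_eq_left hs]
    exact Complex.re_add_im s
  refine ⟨fun s ↦ (g₀ (1 + P s) - 1) / (1 + P s), ?_, fun ε hε t ↦ ?_⟩
  · refine Continuous.div ((hg₀.comp_continuous (by fun_prop) fun s ↦ ?_).sub continuous_const)
      (by fun_prop) fun s h ↦ ?_
    · simp only [mem_ofPred_eq, Complex.add_re, Complex.one_re, hPre]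
      linarith [le_max_right s.re 0]
    · have := congrArg Complex.re h
      simp only [Complex.add_re, Complex.one_re, hPre, Complex.zero_re] at this
      linarith [le_max_right s.re 0]
  set s : ℂ := ε + t * Complex.I with hs
  have hsre : s.re = ε := by simp [hs]
  simp only []
  rw [hPid s (by rw [hsre]; exact hε.le)]
  have h1s : 1 < (1 + s).re := by simp [hsre, hε]
  have h1s0 : (1 + s) ≠ 0 := fun h ↦ by
    rw [h] at h1s; simp at h1s; linarith
  have hs0 : s ≠ 0 := fun h ↦ by rw [h] at hsre; simp at hsre; linarith
  have hO : (fun n : ℕ ↦ ∑ k ∈ Finset.Icc 1 n, (vonMangoldt k : ℝ)) =O[atTop]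
      fun n : ℕ ↦ (n : ℝ) ^ (1 : ℝ) := by
    refine Asymptotics.IsBigO.of_bound (Real.log 4 + 4) (Eventually.of_forall fun n ↦ ?_)
    have := Chebyshev.psi_le_const_mul_self (Nat.cast_nonneg (α := ℝ) n)
    have h2 : Chebyshev.psi n = ∑ k ∈ Finset.Icc 1 n, (vonMangoldt k : ℝ) := by
      rw [Chebyshev.psi, Nat.floor_natCast]; rfl
    rw [← h2, Real.rpow_one, Real.norm_of_nonneg (Chebyshev.psi_nonneg _),
      Real.norm_of_nonneg (Nat.cast_nonneg _)]
    exact this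
  have hL := LSeries_eq_mul_integral_of_nonneg (fun n ↦ vonMangoldt n) zero_le_one h1s hO
    fun n ↦ vonMangoldt_nonneg
  have hE := vonMangoldt.eqOn_LFunctionResidueClassAux (a := (1 : ZMod 1)) isUnit_one h1s
  have hres : vonMangoldt.residueClass (1 : ZMod 1) = fun n ↦ vonMangoldt n := by
    funext n
    have : (n : ZMod 1) = 1 := Subsingleton.elim _ _
    simp [vonMangoldt.residueClass, this]
  simp only [hres, hL, Nat.totient_one, Nat.cast_one, inv_one, add_sub_cancel_left] at hE
  have himg : Real.exp '' Ioi 0 = Ioi 1 := by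
    ext x
    simp only [mem_image, mem_Ioi]
    constructor
    · rintro ⟨u, hu, rfl⟩
      exact Real.one_lt_exp_iff.2 hu
    · exact fun hx ↦ ⟨Real.log x, Real.log_pos hx, Real.exp_log (by linarith)⟩
  have hcv := integral_image_eq_integral_abs_deriv_smul (measurableSet_Ioi (a := (0:ℝ)))
    (fun u _ ↦ (Real.hasDerivAt_exp u).hasDerivWithinAt) Real.exp_injective.injOn
    (fun t : ℝ ↦ (∑ k ∈ Finset.Icc 1 ⌊t⌋₊, ((vonMangoldt k : ℝ) : ℂ)) * (t : ℂ) ^ (-(1 + s + 1)))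
  rw [himg] at hcv
  have hpt : ∀ u : ℝ, |Real.exp u| • ((∑ k ∈ Finset.Icc 1 ⌊Real.exp u⌋₊,
      ((vonMangoldt k : ℝ) : ℂ)) * ((Real.exp u : ℝ) : ℂ) ^ (-(1 + s + 1))) =
      ((Chebyshev.psi (Real.exp u) * Real.exp (-u) : ℝ) : ℂ) * Complex.exp (-s * u) := by
    intro u
    have h2 : ∑ k ∈ Finset.Icc 1 ⌊Real.exp u⌋₊, ((vonMangoldt k : ℝ) : ℂ) =
        (Chebyshev.psi (Real.exp u) : ℂ) := by
      rw [Chebyshev.psi]; push_cast; rfl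
    rw [h2, Real.abs_exp, Complex.real_smul, Complex.cpow_def_of_ne_zero
      (by exact_mod_cast (Real.exp_pos u).ne'), ← Complex.ofReal_log (Real.exp_pos u).le,
      Real.log_exp]
    push_cast
    rw [mul_left_comm, mul_assoc, ← Complex.exp_add, ← Complex.exp_add]
    congr 2; ring
  simp only [hpt] at hcv
  rw [hcv] at hE
  have hexpi : Integrable (fun u : ℝ ↦ Complex.exp (-s * u)) (volume.restrict (Ioi 0)) :=
    integrableOn_exp_mul_complex_Ioi (by simp [hsre, hε]) 0
  have hexpv : ∫ u in Ioi (0:ℝ), Complex.exp (-s * u) = 1 / s := by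
    rw [integral_exp_mul_complex_Ioi (by simp [hsre, hε])]
    simp [neg_div_neg_eq]
  have hBi : Integrable (fun u : ℝ ↦ ((Chebyshev.psi (Real.exp u) * Real.exp (-u) : ℝ) : ℂ) *
      Complex.exp (-s * u)) (volume.restrict (Ioi 0)) := by
    refine hexpi.bdd_mul (c := Real.log 4 + 4) ?_ (ae_of_all _ fun u ↦ ?_)
    · have := Chebyshev.psi_mono.measurable
      exact Measurable.aestronglyMeasurable (by fun_prop)
    · rw [Complex.norm_real, Real.norm_of_nonneg
        (mul_nonneg (Chebyshev.psi_nonneg _) (Real.exp_pos _).le)]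
      have := mul_le_mul_of_nonneg_right
        (Chebyshev.psi_le_const_mul_self (Real.exp_pos u).le) (Real.exp_pos (-u)).le
      rwa [mul_assoc, ← Real.exp_add, add_neg_cancel, Real.exp_zero, mul_one] at this
  have hsplit : ∀ u : ℝ, ((Chebyshev.psi (Real.exp u) * Real.exp (-u) - 1 : ℝ) : ℂ) *
      Complex.exp (-s * u) = ((Chebyshev.psi (Real.exp u) * Real.exp (-u) : ℝ) : ℂ) *
      Complex.exp (-s * u) - Complex.exp (-s * u) := fun u ↦ by push_cast; ring
  simp_rw [hsplit]
  rw [integral_sub hBi hexpi, hexpv]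
  change g₀ (1 + s) = _ at hE
  rw [hE]
  field_simp
  ring

/-- The **prime number theorem** for `ψ`. -/
theorem tendsto_psi_div : Tendsto (fun x ↦ Chebyshev.psi x / x) atTop (𝓝 1) := by
  set B : ℝ → ℝ := fun u ↦ Chebyshev.psi (Real.exp u) * Real.exp (-u) with hB
  have hm : Measurable B := by
    have := Chebyshev.psi_mono.measurable
    fun_prop
  have hB0 : ∀ u, 0 ≤ B u := fun u ↦ mul_nonneg (Chebyshev.psi_nonneg _) (Real.exp_pos _).le
  have hBM : ∀ u, B u ≤ Real.log 4 + 4 := fun u ↦ by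
    have := mul_le_mul_of_nonneg_right
      (Chebyshev.psi_le_const_mul_self (Real.exp_pos u).le) (Real.exp_pos (-u)).le
    rwa [mul_assoc, ← Real.exp_add, add_neg_cancel, Real.exp_zero, mul_one] at this
  have hBneg : ∀ u ≤ 0, B u = 0 := fun u hu ↦ by
    simp [hB, Chebyshev.psi_eq_zero_of_le_one (Real.exp_le_one_iff.2 hu)]
  have hlog4 : 0 ≤ Real.log 4 := Real.log_nonneg (by norm_num)
  obtain ⟨g, hg, hlap⟩ := exists_continuous_laplace_psi
  have hmain : ∀ T : ℝ, 0 < T → Tendsto (fun y ↦ ∫ w, B (y - w / T) * WienerIkehara.fejer w) atTop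
      (𝓝 (∫ w, WienerIkehara.fejer w)) := by
    intro T hT
    have h1 := WienerIkehara.tendsto_integral_mul_fejer (h := fun u ↦ B u - 1)
      (by fun_prop) (M := Real.log 4 + 4)
      (fun u ↦ abs_le.2 ⟨by linarith [hB0 u], by linarith [hBM u]⟩) hg hlap hT
    have hkint : ∀ y, Integrable (fun u ↦ WienerIkehara.fejer (T * (y - u))) := fun y ↦
      (WienerIkehara.integrable_fejer.comp_mul_left' hT.ne').comp_sub_left y
    have hBk : ∀ y, Integrable fun u ↦ B u * WienerIkehara.fejer (T * (y - u)) := fun y ↦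
      (hkint y).bdd_mul (c := Real.log 4 + 4) hm.aestronglyMeasurable
        (ae_of_all _ fun u ↦ by rw [Real.norm_of_nonneg (hB0 u)]; exact hBM u)
    have hB' : ∀ y, ∫ w, B (y - w / T) * WienerIkehara.fejer w =
        T * ∫ u in Ioi (0:ℝ), B u * WienerIkehara.fejer (T * (y - u)) := by
      intro y
      rw [setIntegral_eq_integral_of_forall_compl_eq_zero fun u hu ↦ by
        rw [hBneg u (not_lt.1 hu), zero_mul]]
      rw [← integral_sub_left_eq_self (fun u ↦ B u * WienerIkehara.fejer (T * (y - u))) volume y]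
      have := Measure.integral_comp_mul_left (fun w ↦ B (y - w / T) * WienerIkehara.fejer w) T
      simp only [mul_div_cancel_left₀ _ hT.ne', smul_eq_mul, abs_of_pos (inv_pos.2 hT)] at this
      simp only [sub_sub_cancel]
      rw [this, mul_inv_cancel_left₀ hT.ne']
    have hk' : Tendsto (fun y : ℝ ↦ T * ∫ u in Ioi (0:ℝ), WienerIkehara.fejer (T * (y - u))) atTop
        (𝓝 (∫ w, WienerIkehara.fejer w)) := by
      have h2 : Tendsto (fun y : ℝ ↦ ∫ w in Iic (T * y), WienerIkehara.fejer w) atTop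
          (𝓝 (∫ w, WienerIkehara.fejer w)) :=
        ((aecover_Iic tendsto_id).integral_tendsto_of_countably_generated
          WienerIkehara.integrable_fejer).comp (tendsto_id.const_mul_atTop hT)
      refine h2.congr fun y ↦ ?_
      rw [← integral_indicator measurableSet_Iic, ← integral_indicator measurableSet_Ioi]
      rw [← integral_sub_left_eq_self
          ((Ioi (0:ℝ)).indicator fun u ↦ WienerIkehara.fejer (T * (y - u)))
        volume y]
      have := Measure.integral_comp_mul_left ((Iio (T * y)).indicator WienerIkehara.fejer) T
      rw [smul_eq_mul, abs_of_pos (inv_pos.2 hT)] at this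
      have h3 : ∀ x, (Ioi (0:ℝ)).indicator (fun u ↦ WienerIkehara.fejer (T * (y - u))) (y - x) =
          (Iio (T * y)).indicator WienerIkehara.fejer (T * x) := by
        intro x
        simp only [indicator, mem_Ioi, mem_Iio, sub_sub_cancel, sub_pos, mul_lt_mul_iff_right₀ hT]
      simp_rw [h3]
      rw [this, mul_inv_cancel_left₀ hT.ne', integral_indicator measurableSet_Iic,
        integral_indicator measurableSet_Iio, integral_Iic_eq_integral_Iio]
    have h4 := (h1.const_mul T).add hk'
    rw [mul_zero, zero_add] at h4
    refine h4.congr fun y ↦ ?_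
    rw [hB', ← mul_add, ← integral_add]
    · congr 1
      refine integral_congr_ae (ae_of_all _ fun u ↦ ?_)
      ring
    · refine (((hBk y).sub (hkint y)).congr (ae_of_all _ fun u ↦ ?_)).integrableOn
      simp only [Pi.sub_apply]
      ring
    · exact (hkint y).integrableOn
  have hfin := WienerIkehara.tendsto_one_of_fejer_average hm hB0 hBM (fun u v huv ↦ by
    have h1 := Chebyshev.psi_mono (Real.exp_le_exp.2 huv)
    have h2 : Real.exp (u - v) * B u = Chebyshev.psi (Real.exp u) * Real.exp (-v) := by
      rw [hB, mul_left_comm, ← Real.exp_add]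
      congr 2; ring
    rw [h2]
    exact mul_le_mul_of_nonneg_right h1 (Real.exp_pos _).le) hmain
  refine (hfin.comp Real.tendsto_log_atTop).congr' ?_
  filter_upwards [eventually_gt_atTop 0] with x hx
  simp only [Function.comp, hB, Real.exp_neg, Real.exp_log hx, div_eq_mul_inv]

/-- The **prime number theorem** for `θ`. -/
theorem tendsto_theta_div : Tendsto (fun x ↦ Chebyshev.theta x / x) atTop (𝓝 1) := by
  have h1 : Tendsto (fun x : ℝ ↦ 2 * (Real.log x / x ^ (1/2 : ℝ))) atTop (𝓝 0) := by
    have := (isLittleO_log_rpow_atTop (by norm_num : (0:ℝ) < 1/2)).tendsto_div_nhds_zero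
    simpa using this.const_mul 2
  have h2 : Tendsto (fun x : ℝ ↦ (Chebyshev.psi x - Chebyshev.theta x) / x) atTop (𝓝 0) := by
    refine squeeze_zero_norm' ?_ h1
    filter_upwards [eventually_ge_atTop 1] with x hx
    have hx0 : 0 < x := by linarith
    rw [norm_div, Real.norm_eq_abs, Real.norm_of_nonneg hx0.le, div_le_iff₀ hx0]
    refine (Chebyshev.abs_psi_sub_theta_le_sqrt_mul_log hx).trans_eq ?_
    rw [← Real.sqrt_eq_rpow]
    have hs : 0 < √x := Real.sqrt_pos.2 hx0
    field_simp
    rw [Real.sq_sqrt hx0.le]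
    ring
  have h3 := tendsto_psi_div.sub h2
  rw [sub_zero] at h3
  refine h3.congr fun x ↦ ?_
  rw [← sub_div, sub_sub_cancel]

namespace PolyaVinogradov

/-- The modulus of a Gauss sum over a prime field. -/
lemma norm_gaussSum_sq {q : ℕ} [Fact q.Prime] {χ : DirichletCharacter ℂ q} (hχ : χ ≠ 1) :
    ‖gaussSum χ (ZMod.stdAddChar (N := q))‖ ^ 2 = q := by
  have h := gaussSum_mul_gaussSum_eq_card hχ (ZMod.isPrimitive_stdAddChar q)
  rw [← star_gaussSum_eq, ZMod.card, ← starRingEnd_apply, Complex.mul_conj,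
    Complex.normSq_eq_norm_sq] at h
  exact_mod_cast h

/-- The twisted Gauss sum evaluates to `χ n` times the Gauss sum. -/
lemma sum_inv_mul_stdAddChar {q : ℕ} [Fact q.Prime] {χ : DirichletCharacter ℂ q} (hχ : χ ≠ 1)
    (n : ZMod q) :
    ∑ a : ZMod q, χ⁻¹ a * ZMod.stdAddChar (n * a) =
      χ n * gaussSum χ⁻¹ (ZMod.stdAddChar (N := q)) := by
  by_cases hn : IsUnit n
  · obtain ⟨u, rfl⟩ := hn
    simpa [gaussSum] using gaussSum_mulShift_eq χ⁻¹ (ZMod.stdAddChar (N := q)) u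
  · rw [MulChar.map_nonunit _ hn, zero_mul]
    have : n = 0 := by rwa [isUnit_iff_ne_zero, not_not] at hn
    simp only [this, zero_mul, AddChar.map_zero_eq_one, mul_one]
    exact MulChar.sum_eq_zero_of_ne_one (inv_ne_one.2 hχ)

lemma one_div_sin_pi_mul_le {t : ℝ} (h0 : 0 < t) (h1 : t < 1) :
    1 / Real.sin (Real.pi * t) ≤ (1 / t + 1 / (1 - t)) / 2 := by
  have hpi := Real.pi_pos
  wlog h : t ≤ 1 / 2 generalizing t
  · have := this (t := 1 - t) (by linarith) (by linarith) (by linarith [not_le.1 h])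
    rw [mul_sub, mul_one, Real.sin_pi_sub, sub_sub_cancel] at this
    linarith
  have h2 : 2 * t ≤ Real.sin (Real.pi * t) := by
    have := Real.mul_le_sin (x := Real.pi * t) (by positivity) (by nlinarith)
    have e : 2 / Real.pi * (Real.pi * t) = 2 * t := by field_simp
    linarith
  have h3 : 1 / Real.sin (Real.pi * t) ≤ 1 / (2 * t) := one_div_le_one_div_of_le (by linarith) h2
  have h4 : 1 / (2 * t) = 1 / t / 2 := by field_simp
  have h5 : 0 < 1 / (1 - t) := by apply one_div_pos.2; linarith
  linarith

lemma norm_sum_stdAddChar_le {q : ℕ} [Fact q.Prime] {a : ZMod q} (ha : a ≠ 0) (N : ℕ) :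
    ‖∑ n ∈ Finset.Icc 1 N, ZMod.stdAddChar ((n : ZMod q) * a)‖ ≤
      q / 2 * (1 / (a.val : ℝ) + 1 / ((q : ℝ) - a.val)) := by
  have hq : (0:ℝ) < q := by exact_mod_cast (Fact.out : q.Prime).pos
  have hav : 0 < (a.val : ℝ) := by exact_mod_cast Nat.pos_of_ne_zero ((ZMod.val_ne_zero a).2 ha)
  have haq : (a.val : ℝ) < q := by exact_mod_cast ZMod.val_lt a
  set z : ℂ := ZMod.stdAddChar a with hz
  have hzexp : z = Complex.exp (Complex.I * ((2 * (Real.pi * (a.val / q)) : ℝ) : ℂ)) := by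
    have := ZMod.stdAddChar_coe (N := q) (a.val : ℤ)
    rw [Int.cast_natCast, ZMod.natCast_zmod_val] at this
    rw [hz, this]
    congr 1
    push_cast
    ring
  have hsin0 : 0 < Real.sin (Real.pi * (a.val / q)) := by
    apply Real.sin_pos_of_pos_of_lt_pi
    · have := Real.pi_pos; positivity
    · have : (a.val : ℝ) / q < 1 := (div_lt_one hq).2 haq
      nlinarith [Real.pi_pos]
  have hnorm : ‖z - 1‖ = 2 * Real.sin (Real.pi * (a.val / q)) := by
    rw [hzexp, Complex.norm_exp_I_mul_ofReal_sub_one, mul_div_cancel_left₀ _ two_ne_zero,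
      Real.norm_of_nonneg (by positivity)]
  have hz1 : ‖z‖ = 1 := by rw [hzexp, mul_comm, Complex.norm_exp_ofReal_mul_I]
  have hne : z ≠ 1 := by
    intro h
    rw [h, sub_self, norm_zero] at hnorm
    linarith
  have hsum : ∑ n ∈ Finset.Icc 1 N, ZMod.stdAddChar ((n : ZMod q) * a) =
      (z ^ (N + 1) - z) / (z - 1) := by
    have h1 : ∀ n : ℕ, ZMod.stdAddChar ((n : ZMod q) * a) = z ^ n := by
      intro n
      rw [hz, ← AddChar.map_nsmul_eq_pow, nsmul_eq_mul]
    simp_rw [h1]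
    have h2 := geom_sum_Ico hne (show 1 ≤ N + 1 by omega)
    rw [pow_one] at h2
    rw [← h2]
    rfl
  rw [hsum, norm_div, hnorm]
  have hb : ‖z ^ (N + 1) - z‖ ≤ 2 := by
    refine (norm_sub_le _ _).trans ?_
    rw [norm_pow, hz1]
    norm_num
  have h3 := one_div_sin_pi_mul_le (t := a.val / q) (by positivity) ((div_lt_one hq).2 haq)
  calc ‖z ^ (N + 1) - z‖ / (2 * Real.sin (Real.pi * (a.val / q)))
      ≤ 2 / (2 * Real.sin (Real.pi * (a.val / q))) := by gcongr
    _ = 1 / Real.sin (Real.pi * (a.val / q)) := by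
      field_simp
    _ ≤ _ := h3
    _ = _ := by
      have : (q : ℝ) - a.val ≠ 0 := by linarith
      have e : 1 - (a.val : ℝ) / q = (q - a.val) / q := by field_simp
      rw [e]
      field_simp

lemma sum_reciprocals_le (q : ℕ) [Fact q.Prime] :
    ∑ a : ZMod q, (if a = 0 then (0:ℝ) else
      q / 2 * (1 / (a.val : ℝ) + 1 / ((q : ℝ) - a.val))) ≤ q * (1 + Real.log q) := by
  have hqp : 2 ≤ q := (Fact.out : q.Prime).two_le
  obtain ⟨m, rfl⟩ : ∃ m, q = m + 1 := ⟨q - 1, by omega⟩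
  have h1 : ∑ a : ZMod (m + 1), (if a = 0 then (0:ℝ) else
      (m + 1 : ℕ) / 2 * (1 / (a.val : ℝ) + 1 / (((m + 1 : ℕ) : ℝ) - a.val))) =
      ∑ k ∈ Finset.range (m + 1), (if k = 0 then (0:ℝ) else
      (m + 1 : ℕ) / 2 * (1 / (k : ℝ) + 1 / (((m + 1 : ℕ) : ℝ) - k))) := by
    rw [Finset.sum_range]
    refine Finset.sum_congr rfl fun a _ ↦ ?_
    have h : a = 0 ↔ Fin.val (n := m + 1) a = 0 := (ZMod.val_eq_zero a).symm
    by_cases h0 : a = 0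
    · rw [if_pos h0, if_pos (h.1 h0)]
    · rw [if_neg h0, if_neg (mt h.2 h0)]
      rfl
  rw [h1, Finset.sum_range_succ']
  simp only [if_true, add_zero, Nat.add_eq_zero_iff, one_ne_zero, and_false, if_false]
  rw [← Finset.mul_sum, Finset.sum_add_distrib]
  have h2 : ∑ k ∈ Finset.range m, 1 / (((k + 1 : ℕ) : ℝ)) = (harmonic m : ℝ) := by
    simp [harmonic]
  have h3 : ∑ k ∈ Finset.range m, 1 / (((m + 1 : ℕ) : ℝ) - ((k + 1 : ℕ) : ℝ)) =
      (harmonic m : ℝ) := by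
    rw [← h2, ← Finset.sum_range_reflect]
    refine Finset.sum_congr rfl fun k hk ↦ ?_
    have hk := Finset.mem_range.1 hk
    congr 1
    rw [Nat.sub_sub, show m - (1 + k) + 1 = m - k by omega, Nat.cast_sub hk.le]
    push_cast
    ring
  rw [h2, h3]
  have h4 := harmonic_le_one_add_log m
  have h5 : Real.log m ≤ Real.log (m + 1 : ℕ) :=
    Real.log_le_log (by exact_mod_cast (by omega : 0 < m)) (by exact_mod_cast Nat.le_succ m)
  have h6 : (0:ℝ) < (m + 1 : ℕ) := by positivity
  nlinarith

/-- The **Pólya–Vinogradov inequality** for prime moduli. -/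
theorem norm_sum_le {q : ℕ} [Fact q.Prime] {χ : DirichletCharacter ℂ q} (hχ : χ ≠ 1) (N : ℕ) :
    ‖∑ n ∈ Finset.Icc 1 N, χ n‖ ≤ √q * (1 + Real.log q) := by
  have hq : (0:ℝ) < q := by exact_mod_cast (Fact.out : q.Prime).pos
  have hτ : ‖gaussSum χ⁻¹ (ZMod.stdAddChar (N := q))‖ = √q := by
    rw [← norm_gaussSum_sq (inv_ne_one.2 hχ), Real.sqrt_sq (norm_nonneg _)]
  have key : (∑ n ∈ Finset.Icc 1 N, χ n) * gaussSum χ⁻¹ (ZMod.stdAddChar (N := q)) =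
      ∑ a : ZMod q, χ⁻¹ a * ∑ n ∈ Finset.Icc 1 N, ZMod.stdAddChar ((n : ZMod q) * a) := by
    rw [Finset.sum_mul]
    simp_rw [← sum_inv_mul_stdAddChar hχ, Finset.mul_sum]
    exact Finset.sum_comm
  have hb : ‖∑ a : ZMod q, χ⁻¹ a * ∑ n ∈ Finset.Icc 1 N, ZMod.stdAddChar ((n : ZMod q) * a)‖ ≤
      q * (1 + Real.log q) := by
    refine (_root_.norm_sum_le _ _).trans
      ((Finset.sum_le_sum fun a _ ↦ ?_).trans (sum_reciprocals_le q))
    split_ifs with ha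
    · rw [ha, MulChar.map_zero, zero_mul, norm_zero]
    · rw [norm_mul]
      refine (mul_le_of_le_one_left (norm_nonneg _) (DirichletCharacter.norm_le_one _ _)).trans
        (norm_sum_stdAddChar_le ha N)
  rw [← key, norm_mul, hτ] at hb
  have hs : 0 < √(q:ℝ) := Real.sqrt_pos.2 hq
  refine le_of_mul_le_mul_right (hb.trans_eq ?_) hs
  nth_rewrite 1 [← Real.mul_self_sqrt hq.le]
  ring

end PolyaVinogradov

namespace DirichletPartialSum

open scoped Complex

lemma norm_cpow_sub_cpow_le {s : ℂ} (hs : 0 < s.re) {n : ℕ} (hn : 1 ≤ n) :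
    ‖(n : ℂ) ^ (-s) - ((n + 1 : ℕ) : ℂ) ^ (-s)‖ ≤
      ‖s‖ / s.re * ((n : ℝ) ^ (-s.re) - ((n + 1 : ℕ) : ℝ) ^ (-s.re)) := by
  have hn0 : (0:ℝ) < n := by exact_mod_cast hn
  have hle : (n : ℝ) ≤ (n + 1 : ℕ) := by push_cast; linarith
  have hmem : (0:ℝ) ∉ Set.uIcc (n : ℝ) (n + 1 : ℕ) := by
    rw [Set.uIcc_of_le hle]
    exact fun h ↦ absurd h.1 (not_le.2 hn0)
  have hs0 : s ≠ 0 := by rintro rfl; simp at hs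
  have h1 := integral_cpow (a := n) (b := (n + 1 : ℕ)) (r := -s - 1)
    (Or.inr ⟨by simpa [sub_eq_neg_self] using hs0, hmem⟩)
  have h2 := integral_rpow (a := n) (b := (n + 1 : ℕ)) (r := -s.re - 1)
    (Or.inr ⟨by linarith [hs.ne'] , hmem⟩)
  rw [sub_add_cancel] at h1 h2
  have h3 : (n : ℂ) ^ (-s) - ((n + 1 : ℕ) : ℂ) ^ (-s) =
      s * ∫ x : ℝ in (n:ℝ)..(n + 1 : ℕ), (x : ℂ) ^ (-s - 1) := by
    rw [h1]
    field_simp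
    push_cast
    ring
  have h4 : ‖∫ x : ℝ in (n:ℝ)..(n + 1 : ℕ), (x : ℂ) ^ (-s - 1)‖ ≤
      ∫ x : ℝ in (n:ℝ)..(n + 1 : ℕ), x ^ (-s.re - 1) := by
    refine intervalIntegral.norm_integral_le_of_norm_le hle (ae_of_all _ fun t ht ↦ ?_) ?_
    · rw [Complex.norm_cpow_eq_rpow_re_of_pos (hn0.trans ht.1)]
      simp
    · exact intervalIntegral.intervalIntegrable_rpow (Or.inr hmem)
  rw [h3, norm_mul, div_mul_eq_mul_div, mul_div_assoc]
  refine mul_le_mul_of_nonneg_left (h4.trans_eq ?_) (norm_nonneg _)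
  rw [h2]
  field_simp
  ring

variable {q : ℕ}

/-- Partial sums of a Dirichlet `L`-series. -/
noncomputable def partialL (χ : DirichletCharacter ℂ q) (N : ℕ) (s : ℂ) : ℂ :=
  ∑ n ∈ Finset.Icc 1 N, χ n * (n : ℂ) ^ (-s)

lemma partialL_sub (χ : DirichletCharacter ℂ q) (s : ℂ) {N M : ℕ} (h : N ≤ M) :
    partialL χ M s - partialL χ N s =
      (∑ n ∈ Finset.Icc 1 M, χ n - ∑ n ∈ Finset.Icc 1 N, χ n) * (M : ℂ) ^ (-s) +
      ∑ k ∈ Finset.Ico N M, (∑ n ∈ Finset.Icc 1 k, χ n - ∑ n ∈ Finset.Icc 1 N, χ n) *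
        ((k : ℂ) ^ (-s) - ((k + 1 : ℕ) : ℂ) ^ (-s)) := by
  induction M, h using Nat.le_induction with
  | base => simp
  | succ M h ih =>
    rw [Finset.sum_Ico_succ_top h]
    have e : partialL χ (M + 1) s = partialL χ M s + χ (M + 1 : ℕ) * ((M + 1 : ℕ) : ℂ) ^ (-s) :=
      Finset.sum_Icc_succ_top (by omega) _
    rw [e, add_sub_right_comm, ih, Finset.sum_Icc_succ_top (by omega)]
    ring

lemma norm_partialL_sub_le {χ : DirichletCharacter ℂ q} {P : ℝ}
    (hP : ∀ N : ℕ, ‖∑ n ∈ Finset.Icc 1 N, χ n‖ ≤ P) {s : ℂ} (hs : 0 < s.re) {N M : ℕ}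
    (hN : 1 ≤ N) (h : N ≤ M) :
    ‖partialL χ M s - partialL χ N s‖ ≤ 2 * P * (‖s‖ / s.re) * (N : ℝ) ^ (-s.re) := by
  have hP0 : 0 ≤ P := (norm_nonneg _).trans (hP 0)
  have h2 : ∀ k : ℕ, ‖∑ n ∈ Finset.Icc 1 k, χ n - ∑ n ∈ Finset.Icc 1 N, χ n‖ ≤ 2 * P := fun k ↦
    (norm_sub_le _ _).trans (by linarith [hP k, hP N])
  have h1 : 1 ≤ ‖s‖ / s.re := by
    rw [one_le_div hs]
    exact Complex.re_le_norm s
  have hM0 : (0:ℝ) < M := by exact_mod_cast (by omega : 0 < M)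
  have hMn : ‖(M : ℂ) ^ (-s)‖ = (M : ℝ) ^ (-s.re) := by
    rw [← Complex.ofReal_natCast, Complex.norm_cpow_eq_rpow_re_of_pos hM0, Complex.neg_re]
  have htel : ∑ k ∈ Finset.Ico N M, ((k : ℝ) ^ (-s.re) - ((k + 1 : ℕ) : ℝ) ^ (-s.re)) =
      (N : ℝ) ^ (-s.re) - (M : ℝ) ^ (-s.re) := by
    have := Finset.sum_Ico_sub (fun k : ℕ ↦ (k : ℝ) ^ (-s.re)) h
    rw [← neg_inj, ← Finset.sum_neg_distrib]
    simpa using this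
  rw [partialL_sub χ s h]
  calc _ ≤ 2 * P * (M : ℝ) ^ (-s.re) + ∑ k ∈ Finset.Ico N M, 2 * P *
        (‖s‖ / s.re * ((k : ℝ) ^ (-s.re) - ((k + 1 : ℕ) : ℝ) ^ (-s.re))) := by
        refine (norm_add_le _ _).trans (add_le_add ?_ ((norm_sum_le _ _).trans
          (Finset.sum_le_sum fun k hk ↦ ?_)))
        · rw [norm_mul, hMn]
          exact mul_le_mul_of_nonneg_right (h2 M) (by positivity)
        · rw [norm_mul]
          exact mul_le_mul (h2 k) (norm_cpow_sub_cpow_le hs (hN.trans (Finset.mem_Ico.1 hk).1))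
            (norm_nonneg _) (by positivity)
    _ = 2 * P * ((M : ℝ) ^ (-s.re) + ‖s‖ / s.re * ((N : ℝ) ^ (-s.re) - (M : ℝ) ^ (-s.re))) := by
        rw [← htel, Finset.mul_sum, mul_add, Finset.mul_sum]
    _ ≤ 2 * P * (‖s‖ / s.re * (N : ℝ) ^ (-s.re)) := by
        refine mul_le_mul_of_nonneg_left ?_ (by positivity)
        have : 0 ≤ (M : ℝ) ^ (-s.re) := by positivity
        nlinarith
    _ = _ := by ring

lemma differentiable_partialL (χ : DirichletCharacter ℂ q) (N : ℕ) :
    Differentiable ℂ (partialL χ N) := by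
  refine Differentiable.fun_sum fun n hn ↦ ?_
  have hn0 : (n : ℂ) ≠ 0 := by
    have := (Finset.mem_Icc.1 hn).1
    exact_mod_cast (by omega : n ≠ 0)
  exact (differentiable_id.neg.const_cpow (Or.inl hn0)).const_mul _

lemma deriv_partialL (χ : DirichletCharacter ℂ q) (N : ℕ) (s : ℂ) :
    deriv (partialL χ N) s = -∑ n ∈ Finset.Icc 1 N, (Real.log n : ℂ) * χ n * (n : ℂ) ^ (-s) := by
  refine HasDerivAt.deriv ?_
  rw [← Finset.sum_neg_distrib]
  refine HasDerivAt.fun_sum fun n hn ↦ ?_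
  have hn0 : (n : ℂ) ≠ 0 := by
    have := (Finset.mem_Icc.1 hn).1
    exact_mod_cast (by omega : n ≠ 0)
  have := (((hasDerivAt_id s).neg).const_cpow (c := (n : ℂ)) (Or.inl hn0)).const_mul (χ n)
  refine this.congr_deriv ?_
  rw [Complex.natCast_log, Pi.neg_apply, id]
  ring

/-- The tail bound for the `L`-function, in the half-plane of conditional convergence. -/
theorem norm_LFunction_sub_partialL_le [NeZero q] {χ : DirichletCharacter ℂ q} (hχ : χ ≠ 1) {P : ℝ}
    (hP : ∀ N : ℕ, ‖∑ n ∈ Finset.Icc 1 N, χ n‖ ≤ P) {s : ℂ} (hs : 0 < s.re) {N : ℕ} (hN : 1 ≤ N) :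
    ‖χ.LFunction s - partialL χ N s‖ ≤ 2 * P * (‖s‖ / s.re) * (N : ℝ) ^ (-s.re) := by
  have hP0 : 0 ≤ P := (norm_nonneg _).trans (hP 0)
  have hlim0 : ∀ s : ℂ, 0 < s.re → Tendsto (fun N : ℕ ↦ 2 * P * (‖s‖ / s.re) * (N : ℝ) ^ (-s.re))
      atTop (𝓝 0) := fun s hs ↦ by
    simpa using ((tendsto_rpow_neg_atTop hs).comp tendsto_natCast_atTop_atTop).const_mul
      (2 * P * (‖s‖ / s.re))
  have hconv : ∀ s : ℂ, ∃ l : ℂ, 0 < s.re → Tendsto (fun M ↦ partialL χ M s) atTop (𝓝 l) := by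
    intro s
    by_cases hs : 0 < s.re
    · have : CauchySeq (fun M ↦ partialL χ (M + 1) s) := by
        refine cauchySeq_of_le_tendsto_0'
          (fun N ↦ 2 * P * (‖s‖ / s.re) * ((N + 1 : ℕ) : ℝ) ^ (-s.re))
          (fun n m hnm ↦ ?_) ((tendsto_add_atTop_iff_nat 1).2 (hlim0 s hs))
        rw [dist_comm, dist_eq_norm]
        exact norm_partialL_sub_le hP hs (by omega) (by omega)
      obtain ⟨l, hl⟩ := cauchySeq_tendsto_of_complete this
      exact ⟨l, fun _ ↦ (tendsto_add_atTop_iff_nat 1).1 hl⟩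
    · exact ⟨0, fun h ↦ absurd h hs⟩
  choose F hF using hconv
  have hbound : ∀ s : ℂ, 0 < s.re → ∀ N : ℕ, 1 ≤ N →
      ‖F s - partialL χ N s‖ ≤ 2 * P * (‖s‖ / s.re) * (N : ℝ) ^ (-s.re) := by
    intro s hs N hN
    refine le_of_tendsto (((hF s hs).sub_const _).norm) ?_
    filter_upwards [eventually_ge_atTop N] with M hM
    exact norm_partialL_sub_le hP hs hN hM
  have hopen : IsOpen {s : ℂ | 0 < s.re} := isOpen_lt continuous_const Complex.continuous_re
  have hunif : TendstoLocallyUniformlyOn (partialL χ) F atTop {s : ℂ | 0 < s.re} := by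
    rw [tendstoLocallyUniformlyOn_iff_forall_isCompact hopen]
    intro K hK hKc
    rcases K.eq_empty_or_nonempty with rfl | hne
    · exact tendstoUniformlyOn_empty
    obtain ⟨s0, hs0K, hs0⟩ := hKc.exists_isMinOn hne Complex.continuous_re.continuousOn
    obtain ⟨R, hR⟩ := hKc.isBounded.exists_norm_le
    have hs0p : 0 < s0.re := hK hs0K
    rw [Metric.tendstoUniformlyOn_iff]
    intro ε hε
    have hl : Tendsto (fun N : ℕ ↦ 2 * P * (R / s0.re) * (N : ℝ) ^ (-s0.re)) atTop (𝓝 0) := by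
      simpa using ((tendsto_rpow_neg_atTop hs0p).comp tendsto_natCast_atTop_atTop).const_mul
        (2 * P * (R / s0.re))
    filter_upwards [hl.eventually_lt_const hε, eventually_ge_atTop 1] with N hN1 hN s hs
    have hre : s0.re ≤ s.re := hs0 hs
    have hR0 : 0 ≤ R := (norm_nonneg _).trans (hR s hs)
    rw [dist_eq_norm]
    refine (hbound s (hK hs) N hN).trans_lt (lt_of_le_of_lt ?_ hN1)
    have h1 : (N : ℝ) ^ (-s.re) ≤ (N : ℝ) ^ (-s0.re) :=
      Real.rpow_le_rpow_of_exponent_le (by exact_mod_cast hN) (by linarith)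
    have h2 : ‖s‖ / s.re ≤ R / s0.re := div_le_div₀ hR0 (hR s hs) hs0p hre
    have h3 : 0 ≤ ‖s‖ / s.re := div_nonneg (norm_nonneg _) (hs0p.le.trans hre)
    gcongr
  have hFd : DifferentiableOn ℂ F {s : ℂ | 0 < s.re} :=
    hunif.differentiableOn
      (Eventually.of_forall fun N ↦ (differentiable_partialL χ N).differentiableOn)
      hopen
  have hL : Differentiable ℂ χ.LFunction := DirichletCharacter.differentiable_LFunction hχ
  have heq : EqOn F χ.LFunction {s : ℂ | 0 < s.re} := by
    refine AnalyticOnNhd.eqOn_of_preconnected_of_eventuallyEq (z₀ := 2) (hFd.analyticOnNhd hopen)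
      (hL.differentiableOn.analyticOnNhd hopen)
      (convex_halfSpace_re_gt 0).isPreconnected (by simp) ?_
    have h1 : {s : ℂ | 1 < s.re} ∈ 𝓝 (2 : ℂ) :=
      (isOpen_lt continuous_const Complex.continuous_re).mem_nhds (by simp)
    filter_upwards [h1] with s hs
    have hs : 1 < s.re := hs
    refine tendsto_nhds_unique (hF s (by linarith)) ?_
    rw [DirichletCharacter.LFunction_eq_LSeries χ hs]
    have h2 := (DirichletCharacter.LSeriesSummable_of_one_lt_re χ hs).hasSum.tendsto_sum_nat
    refine ((tendsto_add_atTop_iff_nat 1).2 h2).congr fun N ↦ ?_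
    rw [Finset.sum_range_succ', LSeries.term_zero, add_zero, partialL, Finset.range_eq_Ico,
      Finset.sum_Ico_add' (fun n ↦ LSeries.term (fun n ↦ χ n) s n) 0 N 1]
    refine Finset.sum_congr rfl fun n hn ↦ ?_
    have hn : 1 ≤ n := by have := (Finset.mem_Ico.1 hn).1; omega
    rw [LSeries.term_of_ne_zero (by omega), Complex.cpow_neg, div_eq_mul_inv]
  rw [← heq hs]
  exact hbound s hs N hN

/-- The corresponding tail bound for the derivative. -/
theorem norm_deriv_LFunction_sub_le [NeZero q] {χ : DirichletCharacter ℂ q} (hχ : χ ≠ 1) {P : ℝ}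
    (hP : ∀ N : ℕ, ‖∑ n ∈ Finset.Icc 1 N, χ n‖ ≤ P) {σ σ' : ℝ} (hσ' : 0 < σ') (hσ : σ' < σ)
    (hσ1 : σ ≤ 1) {N : ℕ} (hN : 1 ≤ N) :
    ‖-deriv χ.LFunction σ - ∑ n ∈ Finset.Icc 1 N, (Real.log n : ℂ) * χ n * (n : ℂ) ^ (-σ : ℂ)‖ ≤
      4 * P / (σ' * (σ - σ')) * (N : ℝ) ^ (-σ') := by
  have hP0 : 0 ≤ P := (norm_nonneg _).trans (hP 0)
  have hL : Differentiable ℂ χ.LFunction := DirichletCharacter.differentiable_LFunction hχ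
  have hA := differentiable_partialL χ N
  have h1 : -deriv χ.LFunction σ -
      ∑ n ∈ Finset.Icc 1 N, (Real.log n : ℂ) * χ n * (n : ℂ) ^ (-σ : ℂ) =
      -deriv (fun s ↦ χ.LFunction s - partialL χ N s) σ := by
    rw [deriv_fun_sub (hL _) (hA _), deriv_partialL]
    ring
  have h2 := Complex.norm_deriv_le_of_forall_mem_sphere_norm_le (c := (σ : ℂ)) (R := σ - σ')
    (C := 4 * P / σ' * (N : ℝ) ^ (-σ')) (f := fun s ↦ χ.LFunction s - partialL χ N s)
    (by linarith) (hL.sub hA).diffContOnCl (fun s hs ↦ ?_)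
  · rw [h1, norm_neg]
    refine h2.trans_eq ?_
    have : σ - σ' ≠ 0 := by linarith
    field_simp
  · rw [mem_sphere_iff_norm] at hs
    have h3 : |s.re - σ| ≤ σ - σ' := by
      have := Complex.abs_re_le_norm (s - σ)
      rwa [hs, Complex.sub_re, Complex.ofReal_re] at this
    have hre : σ' ≤ s.re := by linarith [(abs_le.1 h3).1]
    have hnorm : ‖s‖ ≤ 2 := by
      have : ‖s‖ ≤ ‖s - σ‖ + ‖(σ : ℂ)‖ := by simpa using norm_add_le (s - σ) σ
      rw [hs, Complex.norm_real, Real.norm_of_nonneg (by linarith)] at this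
      linarith
    refine (norm_LFunction_sub_partialL_le hχ hP (hσ'.trans_le hre) hN).trans ?_
    have h4 : (N : ℝ) ^ (-s.re) ≤ (N : ℝ) ^ (-σ') :=
      Real.rpow_le_rpow_of_exponent_le (by exact_mod_cast hN) (by linarith)
    have h5 : ‖s‖ / s.re ≤ 2 / σ' := div_le_div₀ zero_le_two hnorm hσ' hre
    calc 2 * P * (‖s‖ / s.re) * (N : ℝ) ^ (-s.re) ≤ 2 * P * (2 / σ') * (N : ℝ) ^ (-σ') := by gcongr
      _ = _ := by ring

end DirichletPartialSum

namespace CharacterCone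

open DirichletCharacter

variable {q : ℕ}

/-- The nonnegative multiples of evaluation maps on Dirichlet characters. -/
def evalMonoid (q : ℕ) : Submonoid (DirichletCharacter ℂ q → ℂ) where
  carrier := {f | ∃ (c : ℝ) (a : ZMod q), 0 ≤ c ∧ ∀ χ, f χ = c * χ a}
  one_mem' := ⟨1, 1, zero_le_one, fun χ ↦ by simp⟩
  mul_mem' := by
    rintro f g ⟨c, a, hc, hf⟩ ⟨d, b, hd, hg⟩
    refine ⟨c * d, a * b, mul_nonneg hc hd, fun χ ↦ ?_⟩
    rw [Pi.mul_apply, hf, hg, map_mul]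
    push_cast
    ring

/-- The cone of nonnegative combinations of evaluation maps on Dirichlet characters. -/
def charCone (q : ℕ) : Subsemiring (DirichletCharacter ℂ q → ℂ) :=
  (evalMonoid q).subsemiringClosure

lemma mem_charCone_of_eq {f : DirichletCharacter ℂ q → ℂ} {c : ℝ} (hc : 0 ≤ c) (a : ZMod q)
    (h : ∀ χ, f χ = c * χ a) : f ∈ charCone q := by
  rw [charCone, ← SetLike.mem_coe, Submonoid.subsemiringClosure_coe]
  exact AddSubmonoid.subset_closure ⟨c, a, hc, h⟩

lemma charCone_induction {P : (DirichletCharacter ℂ q → ℂ) → Prop}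
    (hgen : ∀ (c : ℝ) (a : ZMod q), 0 ≤ c → P fun χ ↦ c * χ a) (hzero : P 0)
    (hadd : ∀ f g, P f → P g → P (f + g)) {f : DirichletCharacter ℂ q → ℂ}
    (hf : f ∈ charCone q) : P f := by
  rw [charCone, ← SetLike.mem_coe, Submonoid.subsemiringClosure_coe] at hf
  refine AddSubmonoid.closure_induction (motive := fun f _ ↦ P f) (fun f hf ↦ ?_) hzero
    (fun f g _ _ ↦ hadd f g) hf
  obtain ⟨c, a, hc, h⟩ := hf
  rw [show f = fun χ ↦ (c : ℂ) * χ a from funext h]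
  exact hgen c a hc

lemma const_mem {c : ℝ} (hc : 0 ≤ c) : (fun _ ↦ (c : ℂ)) ∈ charCone q :=
  mem_charCone_of_eq hc 1 fun χ ↦ by simp

lemma eval_mem (a : ZMod q) : (fun χ ↦ χ a) ∈ charCone q :=
  mem_charCone_of_eq zero_le_one a fun χ ↦ by simp

lemma smul_mem {c : ℝ} (hc : 0 ≤ c) {f : DirichletCharacter ℂ q → ℂ} (hf : f ∈ charCone q) :
    (fun χ ↦ c * f χ) ∈ charCone q :=
  mul_mem (const_mem hc) hf

lemma star_mem [Fact q.Prime] {f : DirichletCharacter ℂ q → ℂ} (hf : f ∈ charCone q) :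
    star f ∈ charCone q := by
  refine charCone_induction (P := fun f ↦ star f ∈ charCone q) (fun c a hc ↦ ?_) ?_
    (fun f g hf hg ↦ ?_) hf
  · refine mem_charCone_of_eq hc a⁻¹ fun χ ↦ ?_
    rw [Pi.star_apply, star_mul', MulChar.star_apply', MulChar.inv_apply']
    simp
  · rw [star_zero]
    exact zero_mem _
  · rw [star_add]
    exact add_mem hf hg

lemma re_sum_nonneg [NeZero q] {f : DirichletCharacter ℂ q → ℂ} (hf : f ∈ charCone q) :
    0 ≤ (∑ χ, f χ).re := by
  refine charCone_induction (P := fun f ↦ 0 ≤ (∑ χ, f χ).re) (fun c a hc ↦ ?_) ?_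
    (fun f g hf hg ↦ ?_) hf
  · rw [← Finset.mul_sum, sum_characters_eq, Complex.re_ofReal_mul]
    refine mul_nonneg hc ?_
    split_ifs <;> simp
  · simp
  · simp only [Pi.add_apply, Finset.sum_add_distrib, Complex.add_re]
    exact add_nonneg hf hg

lemma norm_apply_eq_one [Fact q.Prime] (χ : DirichletCharacter ℂ q) {a : ZMod q} (ha : a ≠ 0) :
    χ a * star (χ a) = 1 := by
  rw [MulChar.star_apply', MulChar.inv_apply', ← map_mul, mul_inv_cancel₀ ha, map_one]

lemma one_sub_ne_zero (χ : DirichletCharacter ℂ q) (a : ZMod q) {r : ℝ} (h0 : 0 ≤ r) (h1 : r < 1) :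
    1 - r * χ a ≠ 0 := by
  intro h
  have h2 : ‖(r : ℂ) * χ a‖ = 1 := by rw [← sub_eq_zero.1 h, norm_one]
  rw [norm_mul, Complex.norm_real, Real.norm_of_nonneg h0] at h2
  nlinarith [χ.norm_le_one a, norm_nonneg (χ a)]

lemma inv_one_sub_mem [Fact q.Prime] {a : ZMod q} (ha : a ≠ 0) {r : ℝ} (h0 : 0 ≤ r) (h1 : r < 1) :
    (fun χ : DirichletCharacter ℂ q ↦ (1 - r * χ a)⁻¹) ∈ charCone q := by
  have hq : q - 1 ≠ 0 := by have := (Fact.out : q.Prime).two_le; omega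
  have hr : 0 < 1 - r ^ (q - 1) := by linarith [pow_lt_one₀ h0 h1 hq]
  have key : (fun χ : DirichletCharacter ℂ q ↦ (1 - r * χ a)⁻¹) =
      ∑ k ∈ Finset.range (q - 1), fun χ ↦ ((r ^ k / (1 - r ^ (q - 1)) : ℝ) : ℂ) * χ (a ^ k) := by
    funext χ
    rw [Finset.sum_apply]
    have hc : χ a ^ (q - 1) = 1 := by rw [← map_pow, ZMod.pow_card_sub_one_eq_one ha, map_one]
    have hg := mul_neg_geom_sum ((r : ℂ) * χ a) (q - 1)
    rw [mul_pow, hc, mul_one] at hg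
    have hr' : (1 : ℂ) - (r : ℂ) ^ (q - 1) ≠ 0 := by exact_mod_cast hr.ne'
    have : ∑ k ∈ Finset.range (q - 1), ((r ^ k / (1 - r ^ (q - 1)) : ℝ) : ℂ) * χ (a ^ k) =
        (∑ k ∈ Finset.range (q - 1), ((r : ℂ) * χ a) ^ k) / (1 - (r : ℂ) ^ (q - 1)) := by
      rw [Finset.sum_div]
      refine Finset.sum_congr rfl fun k _ ↦ ?_
      rw [map_pow, mul_pow]
      push_cast
      ring
    rw [this, eq_div_iff hr', ← hg, inv_mul_cancel_left₀ (one_sub_ne_zero χ a h0 h1)]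
  rw [key]
  exact sum_mem fun k _ ↦ mem_charCone_of_eq (div_nonneg (pow_nonneg h0 k) hr.le) (a ^ k)
    fun χ ↦ rfl

lemma mul_star_inv_one_sub_sub_mem [Fact q.Prime] {a : ZMod q} (ha : a ≠ 0) {r : ℝ} (h0 : 0 ≤ r)
    (h1 : r < 1) :
    (fun χ : DirichletCharacter ℂ q ↦ (1 - r * χ a)⁻¹ * star ((1 - r * χ a)⁻¹) -
      (((1 - r ^ 2)⁻¹ : ℝ) : ℂ)) ∈ charCone q := by
  have hr : 0 < 1 - r ^ 2 := by nlinarith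
  set u : DirichletCharacter ℂ q → ℂ := fun χ ↦ χ a * (1 - r * χ a)⁻¹ with hu
  have hum : u ∈ charCone q := mul_mem (eval_mem a) (inv_one_sub_mem ha h0 h1)
  have : (fun χ : DirichletCharacter ℂ q ↦ (1 - r * χ a)⁻¹ * star ((1 - r * χ a)⁻¹) -
      (((1 - r ^ 2)⁻¹ : ℝ) : ℂ)) = fun χ ↦ ((r / (1 - r ^ 2) : ℝ) : ℂ) * (u + star u) χ := by
    funext χ
    have h2 := one_sub_ne_zero χ a h0 h1
    have h3 : 1 - (r : ℂ) * star (χ a) ≠ 0 := by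
      have := (star_ne_zero (R := ℂ)).2 h2
      simpa using this
    have h4 : (1 : ℂ) - (r : ℂ) ^ 2 ≠ 0 := by exact_mod_cast hr.ne'
    have h5 := norm_apply_eq_one χ ha
    have e1 : star ((1 - r * χ a)⁻¹) = (1 - (r : ℂ) * star (χ a))⁻¹ := by
      simp
    simp only [hu, Pi.add_apply, Pi.star_apply, star_mul', e1]
    push_cast
    generalize star (χ a) = w at *
    generalize χ a = z at *
    field_simp
    linear_combination (r : ℂ) ^ 2 * h5
  rw [this]
  exact smul_mem (div_nonneg h0 hr.le) (add_mem hum (star_mem hum))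

/-- The resonator. -/
noncomputable def resonator (s : Finset ℕ) (r : ℕ → ℝ) (χ : DirichletCharacter ℂ q) : ℂ :=
  ∏ p ∈ s, (1 - r p * χ p)⁻¹

lemma resonator_mem [Fact q.Prime] {s : Finset ℕ} {r : ℕ → ℝ} (hs : ∀ p ∈ s, (p : ZMod q) ≠ 0)
    (h0 : ∀ p ∈ s, 0 ≤ r p) (h1 : ∀ p ∈ s, r p < 1) :
    (resonator s r : DirichletCharacter ℂ q → ℂ) ∈ charCone q := by
  have : (resonator s r : DirichletCharacter ℂ q → ℂ) =
      ∏ p ∈ s, fun χ : DirichletCharacter ℂ q ↦ (1 - r p * χ p)⁻¹ := by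
    funext χ
    rw [Finset.prod_apply]
    rfl
  rw [this]
  exact prod_mem fun p hp ↦ inv_one_sub_mem (hs p hp) (h0 p hp) (h1 p hp)

lemma resonator_mul_star_sub_mem [Fact q.Prime] {s : Finset ℕ} {r : ℕ → ℝ}
    (hs : ∀ p ∈ s, (p : ZMod q) ≠ 0) (h0 : ∀ p ∈ s, 0 ≤ r p) (h1 : ∀ p ∈ s, r p < 1) :
    (fun χ : DirichletCharacter ℂ q ↦ resonator s r χ * star (resonator s r χ) -
      ((∏ p ∈ s, (1 - r p ^ 2)⁻¹ : ℝ) : ℂ)) ∈ charCone q := by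
  induction s using Finset.induction_on with
  | empty =>
    simp only [resonator, Finset.prod_empty, star_one, mul_one, Complex.ofReal_one, sub_self]
    exact zero_mem _
  | insert p s hp ih =>
    have h0p := h0 p (Finset.mem_insert_self _ _)
    have h1p := h1 p (Finset.mem_insert_self _ _)
    have hsp := hs p (Finset.mem_insert_self _ _)
    have hs' := fun p hp ↦ hs p (Finset.mem_insert_of_mem hp)
    have h0' := fun p hp ↦ h0 p (Finset.mem_insert_of_mem hp)
    have h1' := fun p hp ↦ h1 p (Finset.mem_insert_of_mem hp)
    have hr : 0 < 1 - r p ^ 2 := by nlinarith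
    have hR := resonator_mem hs' h0' h1'
    have := add_mem (mul_mem (mul_star_inv_one_sub_sub_mem hsp h0p h1p) (mul_mem hR (star_mem hR)))
      (smul_mem (inv_nonneg.2 hr.le) (ih hs' h0' h1'))
    convert this using 1
    funext χ
    simp only [resonator, Finset.prod_insert hp, Pi.add_apply, Pi.mul_apply, Pi.star_apply,
      star_mul']
    push_cast
    ring

/-- Weighted character sums. -/
noncomputable def charSum (g : ℕ → ℝ) (N : ℕ) (χ : DirichletCharacter ℂ q) : ℂ :=
  ∑ n ∈ Finset.Icc 1 N, (g n : ℂ) * χ n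

lemma charSum_mem {g : ℕ → ℝ} {N : ℕ} (hg : ∀ n ∈ Finset.Icc 1 N, 0 ≤ g n) :
    (charSum g N : DirichletCharacter ℂ q → ℂ) ∈ charCone q := by
  have : (charSum g N : DirichletCharacter ℂ q → ℂ) =
      ∑ n ∈ Finset.Icc 1 N, fun χ ↦ (g n : ℂ) * χ n := by
    funext χ
    rw [Finset.sum_apply]
    rfl
  rw [this]
  exact sum_mem fun n hn ↦ smul_mem (hg n hn) (eval_mem _)

lemma sum_log_le {s : Finset ℕ} (hs : ∀ p ∈ s, p.Prime) {n : ℕ} (hn : n ≠ 0) :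
    ∑ p ∈ s with p ∣ n, Real.log p ≤ Real.log n := by
  have h1 : ∏ p ∈ s with p ∣ n, p ∣ n :=
    Finset.prod_primes_dvd n (fun p hp ↦ (hs p (Finset.mem_filter.1 hp).1).prime)
      fun p hp ↦ (Finset.mem_filter.1 hp).2
  rw [← Real.log_prod (fun p hp ↦ by
    have := (hs p (Finset.mem_filter.1 hp).1).ne_zero
    exact_mod_cast this), ← Nat.cast_prod]
  have h2 : 0 < ∏ p ∈ s with p ∣ n, p :=
    Finset.prod_pos fun p hp ↦ (hs p (Finset.mem_filter.1 hp).1).pos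
  have h3 := Nat.le_of_dvd (Nat.pos_of_ne_zero hn) h1
  refine Real.log_le_log ?_ ?_
  · exact_mod_cast h2
  · exact_mod_cast h3

lemma sum_Icc_mul {M : Type*} [AddCommMonoid M] {p : ℕ} (hp : 0 < p) (X : ℕ) (f : ℕ → M) :
    ∑ m ∈ Finset.Icc 1 (X / p), f (p * m) = ∑ n ∈ Finset.Icc 1 X with p ∣ n, f n := by
  refine Finset.sum_bij (fun m _ ↦ p * m) (fun m hm ↦ ?_) (fun a _ b _ h ↦ ?_) (fun n hn ↦ ?_)
    fun m _ ↦ rfl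
  · have := Finset.mem_Icc.1 hm
    refine Finset.mem_filter.2 ⟨Finset.mem_Icc.2 ⟨Nat.mul_pos hp this.1, ?_⟩, dvd_mul_right p m⟩
    rw [mul_comm]
    exact (Nat.le_div_iff_mul_le hp).1 this.2
  · exact Nat.eq_of_mul_eq_mul_left hp h
  · obtain ⟨h1, m, rfl⟩ := Finset.mem_filter.1 hn
    have := Finset.mem_Icc.1 h1
    refine ⟨m, Finset.mem_Icc.2 ⟨Nat.pos_of_mul_pos_left (by omega : 0 < p * m), ?_⟩, rfl⟩
    rw [Nat.le_div_iff_mul_le hp, mul_comm]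
    exact this.2

lemma charSum_log_sub_mem {g : ℕ → ℝ} (hg0 : ∀ n, 0 ≤ g n) (hgm : ∀ m n, g (m * n) = g m * g n)
    {s : Finset ℕ} (hs : ∀ p ∈ s, p.Prime) (X : ℕ) :
    (fun χ : DirichletCharacter ℂ q ↦ charSum (fun n ↦ Real.log n * g n) X χ -
      ∑ p ∈ s, ((Real.log p * g p : ℝ) : ℂ) * χ p * charSum g (X / p) χ) ∈ charCone q := by
  have := charSum_mem (q := q) (g := fun n ↦ (Real.log n - ∑ p ∈ s with p ∣ n, Real.log p) * g n)
    (N := X) fun n hn ↦ mul_nonneg (sub_nonneg.2 (sum_log_le hs (by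
      have := (Finset.mem_Icc.1 hn).1
      omega))) (hg0 n)
  convert this using 1
  funext χ
  have h1 : ∀ p ∈ s, ((Real.log p * g p : ℝ) : ℂ) * χ p * charSum g (X / p) χ =
      ∑ n ∈ Finset.Icc 1 X, if p ∣ n then (Real.log p : ℂ) * (g n * χ n) else 0 := by
    intro p hp
    rw [← Finset.sum_filter, ← sum_Icc_mul (hs p hp).pos X fun n ↦
      (Real.log p : ℂ) * (g n * χ n), charSum, Finset.mul_sum]
    refine Finset.sum_congr rfl fun m _ ↦ ?_
    rw [hgm, Nat.cast_mul, map_mul]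
    push_cast
    ring
  rw [Finset.sum_congr rfl h1, Finset.sum_comm, charSum, charSum, ← Finset.sum_sub_distrib]
  refine Finset.sum_congr rfl fun n _ ↦ ?_
  rw [← Finset.sum_filter, ← Finset.sum_mul]
  push_cast
  ring

lemma resonance_mem [Fact q.Prime] {g : ℕ → ℝ} (hg0 : ∀ n, 0 ≤ g n)
    (hgm : ∀ m n, g (m * n) = g m * g n) {s : Finset ℕ} (hs : ∀ p ∈ s, p.Prime)
    (hsq : ∀ p ∈ s, (p : ZMod q) ≠ 0) {r : ℕ → ℝ} (h0 : ∀ p ∈ s, 0 ≤ r p) (h1 : ∀ p ∈ s, r p < 1)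
    (X : ℕ) :
    (fun χ : DirichletCharacter ℂ q ↦ resonator s r χ * star (resonator s r χ) *
      (star (charSum g X χ) * (charSum (fun n ↦ Real.log n * g n) X χ -
        ∑ p ∈ s, ((r p * (Real.log p * g p) : ℝ) : ℂ) * charSum g (X / p) χ))) ∈ charCone q := by
  have hR := resonator_mem hsq h0 h1
  have hA : ∀ N, (charSum g N : DirichletCharacter ℂ q → ℂ) ∈ charCone q := fun N ↦
    charSum_mem fun n _ ↦ hg0 n
  have m1 := mul_mem (mul_mem hR (star_mem hR)) (mul_mem (star_mem (hA X))
    (charSum_log_sub_mem (q := q) hg0 hgm hs X))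
  have m2 : ∀ p ∈ s, (fun χ : DirichletCharacter ℂ q ↦ ((Real.log p * g p : ℝ) : ℂ) *
      (resonator s r * star (resonator (s.erase p) r) *
        (fun χ : DirichletCharacter ℂ q ↦ χ (p : ZMod q)) * star (charSum g X) *
        charSum g (X / p) : DirichletCharacter ℂ q → ℂ) χ) ∈ charCone q := by
    intro p hp
    have hR' := resonator_mem (s := s.erase p) (fun p hp ↦ hsq p (Finset.mem_of_mem_erase hp))
      (fun p hp ↦ h0 p (Finset.mem_of_mem_erase hp)) (fun p hp ↦ h1 p (Finset.mem_of_mem_erase hp))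
    exact smul_mem (mul_nonneg (Real.log_natCast_nonneg p) (hg0 p)) (mul_mem (mul_mem (mul_mem
      (mul_mem hR (star_mem hR')) (eval_mem (p : ZMod q))) (star_mem (hA X))) (hA _))
  convert add_mem m1 (sum_mem m2) using 1
  funext χ
  rw [Pi.add_apply, Finset.sum_apply]
  simp only [Pi.mul_apply, Pi.star_apply]
  have h2 : ∀ p ∈ s, star (resonator s r χ) * (χ p - r p) =
      star (resonator (s.erase p) r χ) * χ p := by
    intro p hp
    have h3 : resonator s r χ = (1 - r p * χ p)⁻¹ * resonator (s.erase p) r χ :=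
      (Finset.mul_prod_erase s (fun p : ℕ ↦ (1 - (r p : ℂ) * χ p)⁻¹) hp).symm
    have h4 : 1 - (r p : ℂ) * star (χ p) ≠ 0 := by
      have := (star_ne_zero (R := ℂ)).2 (one_sub_ne_zero χ p (h0 p hp) (h1 p hp))
      simpa using this
    have e1 : star ((1 - r p * χ p)⁻¹) = (1 - (r p : ℂ) * star (χ p))⁻¹ := by
      simp
    rw [h3, star_mul', e1]
    have h5 := norm_apply_eq_one χ (hsq p hp)
    field_simp
    linear_combination (r p * star (resonator (s.erase p) r χ)) * h5
  have h6 : ∀ p ∈ s, ((Real.log p * g p : ℝ) : ℂ) * (resonator s r χ *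
      star (resonator (s.erase p) r χ) * χ p * star (charSum g X χ) * charSum g (X / p) χ) =
      resonator s r χ * star (resonator s r χ) * (star (charSum g X χ) *
        (((Real.log p * g p : ℝ) : ℂ) * χ p * charSum g (X / p) χ -
        ((r p * (Real.log p * g p) : ℝ) : ℂ) * charSum g (X / p) χ)) := by
    intro p hp
    simp only [Complex.ofReal_mul]
    linear_combination (-((Real.log p : ℂ) * g p) * resonator s r χ * star (charSum g X χ) *
      charSum g (X / p) χ) * h2 p hp
  rw [Finset.sum_congr rfl h6, ← Finset.mul_sum, ← Finset.mul_sum, Finset.sum_sub_distrib]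
  ring

lemma sum_ofReal_nonneg [NeZero q] {h : DirichletCharacter ℂ q → ℝ}
    (hm : (fun χ ↦ (h χ : ℂ)) ∈ charCone q) : 0 ≤ ∑ χ, h χ := by
  have := re_sum_nonneg hm
  rwa [← Complex.ofReal_sum, Complex.ofReal_re] at this

lemma mul_star_eq (z : ℂ) : z * star z = ((‖z‖ ^ 2 : ℝ) : ℂ) := by
  rw [← starRingEnd_apply, Complex.mul_conj']
  push_cast
  rfl

section moments

variable [Fact q.Prime] {g : ℕ → ℝ} {s : Finset ℕ} {r : ℕ → ℝ}
  {X : ℕ}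

lemma charSum_sub_one_mem (hg0 : ∀ n, 0 ≤ g n) (hg1 : g 1 = 1) (hX : 1 ≤ X) :
    (charSum g X - 1 : DirichletCharacter ℂ q → ℂ) ∈ charCone q := by
  obtain ⟨N, rfl⟩ : ∃ N, X = N + 1 := ⟨X - 1, by omega⟩
  have h2 : (charSum g (N + 1) - 1 : DirichletCharacter ℂ q → ℂ) =
      ∑ n ∈ Finset.Icc 2 (N + 1), fun χ : DirichletCharacter ℂ q ↦ (g n : ℂ) * χ n := by
    funext χ
    rw [Finset.sum_apply, Pi.sub_apply, charSum, ← Finset.add_sum_Ioc_eq_sum_Icc (by omega)]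
    simp only [hg1, Nat.cast_one, map_one, Pi.one_apply, Complex.ofReal_one, mul_one]
    rw [add_sub_cancel_left]
    rfl
  rw [h2]
  exact sum_mem fun n _ ↦ smul_mem (hg0 n) (eval_mem _)

lemma norm_sq_charSum_sub_one_mem (hg0 : ∀ n, 0 ≤ g n) (hg1 : g 1 = 1) (hX : 1 ≤ X) :
    (charSum g X * star (charSum g X) - 1 : DirichletCharacter ℂ q → ℂ) ∈ charCone q := by
  have m := charSum_sub_one_mem (q := q) hg0 hg1 hX
  have mA : (charSum g X : DirichletCharacter ℂ q → ℂ) ∈ charCone q :=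
    charSum_mem fun n _ ↦ hg0 n
  convert add_mem (mul_mem m (star_mem mA)) (star_mem m) using 1
  rw [star_sub, star_one]
  ring

lemma sum_norm_resonator_le
    (hsq : ∀ p ∈ s, (p : ZMod q) ≠ 0) (h0 : ∀ p ∈ s, 0 ≤ r p) (h1 : ∀ p ∈ s, r p < 1)
    (hg0 : ∀ n, 0 ≤ g n) (hg1 : g 1 = 1) (hX : 1 ≤ X) :
    ∑ χ : DirichletCharacter ℂ q, ‖resonator s r χ‖ ^ 2 ≤
      ∑ χ : DirichletCharacter ℂ q, ‖resonator s r χ‖ ^ 2 * ‖charSum g X χ‖ ^ 2 := by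
  have hR := resonator_mem hsq h0 h1
  rw [← sub_nonneg, ← Finset.sum_sub_distrib]
  refine sum_ofReal_nonneg ?_
  convert mul_mem (mul_mem hR (star_mem hR)) (norm_sq_charSum_sub_one_mem (q := q) hg0 hg1 hX)
    using 1
  funext χ
  simp only [Pi.mul_apply, Pi.sub_apply, Pi.star_apply, Pi.one_apply, mul_star_eq]
  push_cast
  ring

lemma le_sum_norm_resonator
    (hsq : ∀ p ∈ s, (p : ZMod q) ≠ 0) (h0 : ∀ p ∈ s, 0 ≤ r p) (h1 : ∀ p ∈ s, r p < 1)
    (hg0 : ∀ n, 0 ≤ g n) (hg1 : g 1 = 1) (hX : 1 ≤ X) :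
    (∏ p ∈ s, (1 - r p ^ 2)⁻¹) * ((q : ℝ) - 1) ≤
      ∑ χ : DirichletCharacter ℂ q, ‖resonator s r χ‖ ^ 2 * ‖charSum g X χ‖ ^ 2 := by
  refine le_trans ?_ (sum_norm_resonator_le hsq h0 h1 hg0 hg1 hX)
  have hcard : (∑ _χ : DirichletCharacter ℂ q, (1 : ℝ)) = (q : ℝ) - 1 := by
    have h := sum_characters_eq (R := ℂ) (1 : ZMod q)
    simp only [map_one, if_true] at h
    have hq := (Fact.out : q.Prime)
    rw [Nat.totient_prime hq, Nat.cast_sub hq.one_lt.le] at h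
    have : ((∑ _χ : DirichletCharacter ℂ q, (1 : ℝ) : ℝ) : ℂ) = ((q : ℝ) - 1 : ℝ) := by
      push_cast
      simpa using h
    exact_mod_cast this
  rw [← hcard, Finset.mul_sum, ← sub_nonneg, ← Finset.sum_sub_distrib]
  refine sum_ofReal_nonneg ?_
  convert resonator_mul_star_sub_mem (q := q) hsq h0 h1 using 1
  funext χ
  rw [mul_star_eq, mul_one]
  push_cast
  ring

lemma sum_norm_resonator_log_le
    (hsq : ∀ p ∈ s, (p : ZMod q) ≠ 0) (h0 : ∀ p ∈ s, 0 ≤ r p) (h1 : ∀ p ∈ s, r p < 1)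
    (hg0 : ∀ n, 0 ≤ g n) :
    ∑ χ : DirichletCharacter ℂ q, ‖resonator s r χ‖ ^ 2 *
        ‖charSum (fun n ↦ Real.log n * g n) X χ‖ ^ 2 ≤
      Real.log X ^ 2 *
        ∑ χ : DirichletCharacter ℂ q, ‖resonator s r χ‖ ^ 2 * ‖charSum g X χ‖ ^ 2 := by
  have hR := resonator_mem hsq h0 h1
  have hl : 0 ≤ Real.log X := Real.log_natCast_nonneg X
  have mA : (charSum g X : DirichletCharacter ℂ q → ℂ) ∈ charCone q :=
    charSum_mem fun n _ ↦ hg0 n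
  have mB : (charSum (fun n ↦ Real.log n * g n) X : DirichletCharacter ℂ q → ℂ) ∈ charCone q :=
    charSum_mem fun n _ ↦ mul_nonneg (Real.log_natCast_nonneg n) (hg0 n)
  have mC : (charSum (fun n ↦ (Real.log X - Real.log n) * g n) X : DirichletCharacter ℂ q → ℂ) ∈
      charCone q := by
    refine charSum_mem fun n hn ↦ mul_nonneg (sub_nonneg.2 ?_) (hg0 n)
    obtain ⟨hn1, hn2⟩ := Finset.mem_Icc.1 hn
    exact Real.log_le_log (by exact_mod_cast hn1) (by exact_mod_cast hn2)
  have hC : ∀ χ : DirichletCharacter ℂ q, charSum (fun n ↦ (Real.log X - Real.log n) * g n) X χ =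
      (Real.log X : ℂ) * charSum g X χ - charSum (fun n ↦ Real.log n * g n) X χ := by
    intro χ
    simp only [charSum, Finset.mul_sum, ← Finset.sum_sub_distrib, Complex.ofReal_mul,
      Complex.ofReal_sub]
    exact Finset.sum_congr rfl fun n _ ↦ by ring
  have hCs : ∀ χ : DirichletCharacter ℂ q,
      star (charSum (fun n ↦ (Real.log X - Real.log n) * g n) X χ) =
      (Real.log X : ℂ) * star (charSum g X χ) - star (charSum (fun n ↦ Real.log n * g n) X χ) := by
    intro χ
    rw [hC, star_sub, star_mul', Complex.star_def, Complex.conj_ofReal]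
  rw [← sub_nonneg, Finset.mul_sum, ← Finset.sum_sub_distrib]
  refine sum_ofReal_nonneg ?_
  convert mul_mem (mul_mem hR (star_mem hR)) (add_mem (mul_mem mC (smul_mem hl (star_mem mA)))
    (mul_mem mB (star_mem mC))) using 1
  funext χ
  simp only [Pi.mul_apply, Pi.add_apply, Pi.star_apply]
  rw [hCs, hC]
  have e1 := mul_star_eq (resonator s r χ)
  have e2 := mul_star_eq (charSum g X χ)
  have e3 := mul_star_eq (charSum (fun n ↦ Real.log n * g n) X χ)
  simp only [Complex.ofReal_sub, Complex.ofReal_mul, Complex.ofReal_pow] at e1 e2 e3 ⊢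
  rw [e1, ← e2, ← e3]
  ring

end moments

/-- Pointwise comparison at a character where the truncations are accurate. -/
lemma re_star_mul_le {s : Finset ℕ} {w : ℕ → ℝ} (hw : ∀ p ∈ s, 0 ≤ w p) {V η : ℝ} (hV : 0 ≤ V)
    (hη0 : 0 ≤ η) (hη1 : η ≤ 1) {L D A B : ℂ} {a : ℕ → ℂ}
    (hLD : (D * star L).re ≤ V * ‖L‖ ^ 2) (hA : ‖L - A‖ ≤ η) (ha : ∀ p ∈ s, ‖L - a p‖ ≤ η)
    (hB : ‖D - B‖ ≤ η) :
    (star A * (B - ∑ p ∈ s, (w p : ℂ) * a p)).re ≤ (V - ∑ p ∈ s, w p) * ‖A‖ ^ 2 +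
      η * (2 * V + ∑ p ∈ s, w p + 3) * (1 + ‖A‖ ^ 2) + η * ‖B‖ ^ 2 := by
  set W := ∑ p ∈ s, w p with hWdef
  have hW : 0 ≤ W := Finset.sum_nonneg hw
  have hL : ‖L‖ ≤ ‖A‖ + η := by
    have := norm_add_le (L - A) A
    rw [sub_add_cancel] at this
    linarith
  have hL2 : ‖L‖ ^ 2 ≤ ‖A‖ ^ 2 + 2 * η * ‖A‖ + η ^ 2 := by nlinarith [norm_nonneg L]
  have hDn : ‖D‖ ≤ ‖B‖ + η := by
    have := norm_add_le (D - B) B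
    rw [sub_add_cancel] at this
    linarith
  have t1 : -((D - B) * star A).re ≤ η * ‖A‖ := by
    have := Complex.abs_re_le_norm ((D - B) * star A)
    rw [norm_mul, norm_star] at this
    have h2 := mul_le_mul_of_nonneg_right hB (norm_nonneg A)
    linarith [neg_abs_le ((D - B) * star A).re]
  have t2 : -(D * star (L - A)).re ≤ (‖B‖ + η) * η := by
    have := Complex.abs_re_le_norm (D * star (L - A))
    rw [norm_mul, norm_star] at this
    have h2 : ‖D‖ * ‖L - A‖ ≤ (‖B‖ + η) * η := mul_le_mul hDn hA (norm_nonneg _) (by positivity)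
    linarith [neg_abs_le (D * star (L - A)).re]
  have t3 : ∀ p ∈ s, -(star A * ((w p : ℂ) * a p)).re ≤ w p * (-‖A‖ ^ 2 + 2 * η * ‖A‖) := by
    intro p hp
    have e : (star A * ((w p : ℂ) * a p)).re = w p * (‖A‖ ^ 2 + (star A * (a p - A)).re) := by
      have e2 : star A * ((w p : ℂ) * a p) =
          (w p : ℂ) * (((‖A‖ ^ 2 : ℝ) : ℂ) + star A * (a p - A)) := by
        rw [← mul_star_eq A]
        ring
      rw [e2, Complex.re_ofReal_mul, Complex.add_re, Complex.ofReal_re]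
    have h3 := Complex.abs_re_le_norm (star A * (a p - A))
    rw [norm_mul, norm_star] at h3
    have h4 : ‖a p - A‖ ≤ 2 * η := by
      have := norm_sub_le (L - A) (L - a p)
      rw [sub_sub_sub_cancel_left] at this
      linarith [ha p hp]
    have h5 : ‖A‖ * ‖a p - A‖ ≤ ‖A‖ * (2 * η) := mul_le_mul_of_nonneg_left h4 (norm_nonneg _)
    rw [e, ← mul_neg]
    refine mul_le_mul_of_nonneg_left ?_ (hw p hp)
    linarith [neg_abs_le (star A * (a p - A)).re]
  have t4 : -(star A * ∑ p ∈ s, (w p : ℂ) * a p).re ≤ W * (-‖A‖ ^ 2 + 2 * η * ‖A‖) := by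
    rw [Finset.mul_sum, Complex.re_sum, ← Finset.sum_neg_distrib, hWdef, Finset.sum_mul]
    exact Finset.sum_le_sum t3
  have e : (star A * (B - ∑ p ∈ s, (w p : ℂ) * a p)).re = (D * star L).re +
      -((D - B) * star A).re + -(D * star (L - A)).re +
        -(star A * ∑ p ∈ s, (w p : ℂ) * a p).re := by
    rw [← Complex.neg_re, ← Complex.neg_re, ← Complex.neg_re, ← Complex.add_re, ← Complex.add_re,
      ← Complex.add_re, star_sub]
    congr 1
    ring
  rw [e]
  have n1 : 2 * ‖A‖ ≤ 1 + ‖A‖ ^ 2 := by nlinarith [sq_nonneg (‖A‖ - 1)]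
  have n2 : 2 * ‖B‖ ≤ 1 + ‖B‖ ^ 2 := by nlinarith [sq_nonneg (‖B‖ - 1)]
  have n3 : η ^ 2 ≤ η := by nlinarith
  have hVL := mul_le_mul_of_nonneg_left hL2 hV
  have k1 : V * (2 * η * ‖A‖) ≤ V * (η * (1 + ‖A‖ ^ 2)) :=
    mul_le_mul_of_nonneg_left (by nlinarith) hV
  have k2 : V * η ^ 2 ≤ V * (η * (1 + ‖A‖ ^ 2)) :=
    mul_le_mul_of_nonneg_left (by nlinarith [mul_nonneg hη0 (sq_nonneg ‖A‖)]) hV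
  have k3 : W * (2 * η * ‖A‖) ≤ W * (η * (1 + ‖A‖ ^ 2)) :=
    mul_le_mul_of_nonneg_left (by nlinarith) hW
  have k4 : η * ‖A‖ ≤ η * ((1 + ‖A‖ ^ 2) / 2) := mul_le_mul_of_nonneg_left (by linarith) hη0
  have k5 : η * ‖B‖ ≤ η * ((1 + ‖B‖ ^ 2) / 2) := mul_le_mul_of_nonneg_left (by linarith) hη0
  have k6 : 0 ≤ η * ‖A‖ ^ 2 := mul_nonneg hη0 (sq_nonneg _)
  have k7 : 0 ≤ η * ‖B‖ ^ 2 := mul_nonneg hη0 (sq_nonneg _)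
  nlinarith

lemma norm_resonator_one_sq {s : Finset ℕ} {r : ℕ → ℝ} [Fact q.Prime]
    (hsq : ∀ p ∈ s, (p : ZMod q) ≠ 0) :
    ‖resonator s r (1 : DirichletCharacter ℂ q)‖ ^ 2 = ∏ p ∈ s, ((1 - r p) ^ 2)⁻¹ := by
  have h : resonator s r (1 : DirichletCharacter ℂ q) = ((∏ p ∈ s, (1 - r p)⁻¹ : ℝ) : ℂ) := by
    rw [resonator, Complex.ofReal_prod]
    refine Finset.prod_congr rfl fun p hp ↦ ?_
    rw [MulChar.one_apply (hsq p hp).isUnit]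
    push_cast
    ring
  rw [h, Complex.norm_real, Real.norm_eq_abs, sq_abs, ← Finset.prod_pow]
  exact Finset.prod_congr rfl fun p _ ↦ inv_pow _ _

/-- At the principal character, the sums are real and nonnegative. -/
lemma charSum_one (g : ℕ → ℝ) (N : ℕ) (q : ℕ) :
    charSum g N (1 : DirichletCharacter ℂ q) =
      ((∑ n ∈ Finset.Icc 1 N with n.Coprime q, g n : ℝ) : ℂ) := by
  rw [charSum, Finset.sum_filter, Complex.ofReal_sum]
  refine Finset.sum_congr rfl fun n _ ↦ ?_
  split_ifs with h
  · rw [MulChar.one_apply ((ZMod.isUnit_iff_coprime n q).2 h), mul_one]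
  · rw [MulChar.map_nonunit _ (mt (ZMod.isUnit_iff_coprime n q).1 h)]
    simp

/-- The resonance inequality: a bound for the resonating prime sum in terms of a uniform upper
bound for `Re (D / L)` over the nontrivial characters. -/
theorem resonance_inequality [Fact q.Prime] {g : ℕ → ℝ} (hg0 : ∀ n, 0 ≤ g n)
    (hg1 : g 1 = 1) (hgm : ∀ m n, g (m * n) = g m * g n) {s : Finset ℕ} (hs : ∀ p ∈ s, p.Prime)
    (hsq : ∀ p ∈ s, (p : ZMod q) ≠ 0) {r : ℕ → ℝ} (h0 : ∀ p ∈ s, 0 ≤ r p) (h1 : ∀ p ∈ s, r p < 1)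
    {X : ℕ} (hX : 1 ≤ X) {V η : ℝ} (hV : 0 ≤ V) (hη0 : 0 ≤ η) (hη1 : η ≤ 1)
    {L D : DirichletCharacter ℂ q → ℂ}
    (hLD : ∀ χ ≠ 1, (D χ * star (L χ)).re ≤ V * ‖L χ‖ ^ 2)
    (hL : ∀ χ ≠ 1, ‖L χ - charSum g X χ‖ ≤ η)
    (hLp : ∀ χ ≠ 1, ∀ p ∈ s, ‖L χ - charSum g (X / p) χ‖ ≤ η)
    (hD : ∀ χ ≠ 1, ‖D χ - charSum (fun n ↦ Real.log n * g n) X χ‖ ≤ η)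
    (hVW : V ≤ ∑ p ∈ s, r p * (Real.log p * g p)) :
    ∑ p ∈ s, r p * (Real.log p * g p) - V ≤
      (∏ p ∈ s, (1 + r p) / (1 - r p)) * (∑ n ∈ Finset.Icc 1 X, g n) ^ 2 / ((q : ℝ) - 1) *
        (Real.log X + ∑ p ∈ s, r p * (Real.log p * g p)) +
      η * (6 * ∑ p ∈ s, r p * (Real.log p * g p) + 6 + Real.log X ^ 2) := by
  classical
  have hw : ∀ p ∈ s, 0 ≤ r p * (Real.log p * g p) := fun p hp ↦
    mul_nonneg (h0 p hp) (mul_nonneg (Real.log_natCast_nonneg p) (hg0 p))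
  set w : ℕ → ℝ := fun p ↦ r p * (Real.log p * g p) with hwdef
  set W := ∑ p ∈ s, w p with hWdef
  set ℓ := Real.log X with hℓ
  have hℓ0 : 0 ≤ ℓ := Real.log_natCast_nonneg X
  have hW : 0 ≤ W := Finset.sum_nonneg hw
  set N : DirichletCharacter ℂ q → ℝ := fun χ ↦ ‖resonator s r χ‖ ^ 2 with hN
  have hN0 : ∀ χ, 0 ≤ N χ := fun χ ↦ sq_nonneg _
  set A : DirichletCharacter ℂ q → ℂ := charSum g X with hA
  set B : DirichletCharacter ℂ q → ℂ := charSum (fun n ↦ Real.log n * g n) X with hB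
  set S := ∑ χ, N χ * ‖A χ‖ ^ 2 with hS
  have hS1 : ∑ χ, N χ ≤ S := sum_norm_resonator_le hsq h0 h1 hg0 hg1 hX
  have hS2 : ∑ χ, N χ * ‖B χ‖ ^ 2 ≤ ℓ ^ 2 * S := sum_norm_resonator_log_le hsq h0 h1 hg0
  have hS3 : (∏ p ∈ s, (1 - r p ^ 2)⁻¹) * ((q : ℝ) - 1) ≤ S :=
    le_sum_norm_resonator hsq h0 h1 hg0 hg1 hX
  set A₁ := ∑ n ∈ Finset.Icc 1 X, g n with hA₁
  have hA₁0 : 0 ≤ A₁ := Finset.sum_nonneg fun n _ ↦ hg0 n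
  have hA1 : ‖A 1‖ ≤ A₁ := by
    rw [hA, charSum_one, Complex.norm_real, Real.norm_of_nonneg (Finset.sum_nonneg fun n _ ↦ hg0 n)]
    exact Finset.sum_le_sum_of_subset_of_nonneg (Finset.filter_subset _ _) fun n _ _ ↦ hg0 n
  set T : DirichletCharacter ℂ q → ℂ := fun χ ↦
    star (A χ) * (B χ - ∑ p ∈ s, (w p : ℂ) * charSum g (X / p) χ) with hT
  have hmain : 0 ≤ ∑ χ, N χ * (T χ).re := by
    have := re_sum_nonneg (resonance_mem (q := q) hg0 hgm hs hsq h0 h1 X)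
    rw [Complex.re_sum] at this
    refine this.trans_eq (Finset.sum_congr rfl fun χ _ ↦ ?_)
    rw [mul_star_eq, Complex.re_ofReal_mul]
  have hT1 : (T 1).re ≤ ℓ * A₁ ^ 2 := by
    have e : T 1 = (((∑ n ∈ Finset.Icc 1 X with n.Coprime q, g n) *
        (∑ n ∈ Finset.Icc 1 X with n.Coprime q, Real.log n * g n - ∑ p ∈ s, w p *
          ∑ n ∈ Finset.Icc 1 (X / p) with n.Coprime q, g n) : ℝ) : ℂ) := by
      simp only [hT, hA, hB, charSum_one, Complex.star_def, Complex.conj_ofReal]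
      simp only [Complex.ofReal_mul, Complex.ofReal_sub, Complex.ofReal_sum]
    rw [e, Complex.ofReal_re]
    have a1 : ∑ n ∈ Finset.Icc 1 X with n.Coprime q, g n ≤ A₁ :=
      Finset.sum_le_sum_of_subset_of_nonneg (Finset.filter_subset _ _) fun n _ _ ↦ hg0 n
    have a0 : 0 ≤ ∑ n ∈ Finset.Icc 1 X with n.Coprime q, g n :=
      Finset.sum_nonneg fun n _ ↦ hg0 n
    have a2 : ∑ n ∈ Finset.Icc 1 X with n.Coprime q, Real.log n * g n ≤ ℓ * A₁ := by
      rw [hA₁, Finset.mul_sum]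
      refine (Finset.sum_le_sum_of_subset_of_nonneg (Finset.filter_subset _ _) fun n _ _ ↦
        mul_nonneg (Real.log_natCast_nonneg n) (hg0 n)).trans (Finset.sum_le_sum fun n hn ↦ ?_)
      obtain ⟨hn1, hn2⟩ := Finset.mem_Icc.1 hn
      exact mul_le_mul_of_nonneg_right
        (Real.log_le_log (by exact_mod_cast hn1) (by exact_mod_cast hn2)) (hg0 n)
    have a3 : 0 ≤ ∑ p ∈ s, w p * ∑ n ∈ Finset.Icc 1 (X / p) with n.Coprime q, g n :=
      Finset.sum_nonneg fun p hp ↦ mul_nonneg (hw p hp) (Finset.sum_nonneg fun n _ ↦ hg0 n)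
    calc _ ≤ (∑ n ∈ Finset.Icc 1 X with n.Coprime q, g n) * (ℓ * A₁) :=
          mul_le_mul_of_nonneg_left (by linarith) a0
      _ ≤ A₁ * (ℓ * A₁) := mul_le_mul_of_nonneg_right a1 (mul_nonneg hℓ0 hA₁0)
      _ = _ := by ring
  have hsplit : ∀ f : DirichletCharacter ℂ q → ℝ,
      ∑ χ, f χ = f 1 + ∑ χ ∈ Finset.univ.erase 1, f χ := fun f ↦
    (Finset.add_sum_erase _ f (Finset.mem_univ _)).symm
  have hpt : ∀ χ ∈ Finset.univ.erase (1 : DirichletCharacter ℂ q), N χ * (T χ).re ≤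
      (V - W) * (N χ * ‖A χ‖ ^ 2) + η * (2 * V + W + 3) * (N χ + N χ * ‖A χ‖ ^ 2) +
        η * (N χ * ‖B χ‖ ^ 2) := by
    intro χ hχ
    have hχ1 := Finset.ne_of_mem_erase hχ
    have := mul_le_mul_of_nonneg_left (re_star_mul_le hw hV hη0 hη1 (hLD χ hχ1) (hL χ hχ1)
      (hLp χ hχ1) (hD χ hχ1)) (hN0 χ)
    refine this.trans_eq ?_
    ring
  have hsum := Finset.sum_le_sum hpt
  rw [Finset.sum_add_distrib, Finset.sum_add_distrib, ← Finset.mul_sum, ← Finset.mul_sum,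
    ← Finset.mul_sum, Finset.sum_add_distrib] at hsum
  have s0 := hsplit fun χ ↦ N χ * (T χ).re
  have s1 := hsplit N
  have s2 := hsplit fun χ ↦ N χ * ‖A χ‖ ^ 2
  have s3 := hsplit fun χ ↦ N χ * ‖B χ‖ ^ 2
  have b1 : 0 ≤ N 1 * ‖A 1‖ ^ 2 := mul_nonneg (hN0 1) (sq_nonneg _)
  have b2 : 0 ≤ N 1 * ‖B 1‖ ^ 2 := mul_nonneg (hN0 1) (sq_nonneg _)
  have b3 : N 1 * ‖A 1‖ ^ 2 ≤ N 1 * A₁ ^ 2 :=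
    mul_le_mul_of_nonneg_left (pow_le_pow_left₀ (norm_nonneg _) hA1 2) (hN0 1)
  have b4 : N 1 * (T 1).re ≤ N 1 * (ℓ * A₁ ^ 2) := mul_le_mul_of_nonneg_left hT1 (hN0 1)
  set S' := ∑ χ ∈ Finset.univ.erase (1 : DirichletCharacter ℂ q), N χ * ‖A χ‖ ^ 2
  set N' := ∑ χ ∈ Finset.univ.erase (1 : DirichletCharacter ℂ q), N χ
  set B' := ∑ χ ∈ Finset.univ.erase (1 : DirichletCharacter ℂ q), N χ * ‖B χ‖ ^ 2
  have c1 : (W - V) * (S - N 1 * A₁ ^ 2) ≤ (W - V) * S' :=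
    mul_le_mul_of_nonneg_left (by linarith) (by linarith)
  have c2 : η * (2 * V + W + 3) * (N' + S') ≤ η * (2 * V + W + 3) * (2 * S) :=
    mul_le_mul_of_nonneg_left (by linarith [hN0 1]) (mul_nonneg hη0 (by linarith))
  have c3 : η * B' ≤ η * (ℓ ^ 2 * S) := mul_le_mul_of_nonneg_left (by linarith) hη0
  have hfin : (W - V) * S ≤ N 1 * A₁ ^ 2 * (ℓ + (W - V)) +
      η * (2 * (2 * V + W + 3) + ℓ ^ 2) * S := by
    linarith
  set K := ∏ p ∈ s, (1 - r p ^ 2)⁻¹ with hK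
  have hKpos : 0 < K := Finset.prod_pos fun p hp ↦ inv_pos.2 (by nlinarith [h0 p hp, h1 p hp])
  have hq1 : 0 < (q : ℝ) - 1 := by
    have := (Fact.out : q.Prime).one_lt
    have : (1 : ℝ) < q := by exact_mod_cast this
    linarith
  have hSpos : 0 < S := (mul_pos hKpos hq1).trans_le hS3
  set G := ∏ p ∈ s, (1 + r p) / (1 - r p) with hG
  have hNG : N 1 = K * G := by
    rw [hN, hK, hG, ← Finset.prod_mul_distrib]
    simp only [norm_resonator_one_sq hsq]
    refine Finset.prod_congr rfl fun p hp ↦ ?_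
    have e1 : 1 - r p ≠ 0 := by linarith [h1 p hp]
    have e2 : 1 + r p ≠ 0 := by linarith [h0 p hp]
    have e3 : 1 - r p ^ 2 ≠ 0 := by
      rw [show 1 - r p ^ 2 = (1 - r p) * (1 + r p) by ring]
      exact mul_ne_zero e1 e2
    field_simp
    ring
  have hG0 : 0 ≤ G := Finset.prod_nonneg fun p hp ↦
    div_nonneg (by linarith [h0 p hp]) (by linarith [h1 p hp])
  have hκ : N 1 * A₁ ^ 2 ≤ G * A₁ ^ 2 / ((q : ℝ) - 1) * S := by
    calc N 1 * A₁ ^ 2 = G * A₁ ^ 2 / ((q : ℝ) - 1) * (K * ((q : ℝ) - 1)) := by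
          rw [hNG]
          field_simp
      _ ≤ _ := mul_le_mul_of_nonneg_left hS3 (div_nonneg (mul_nonneg hG0 (sq_nonneg _)) hq1.le)
  have hfin2 : (W - V) * S ≤ (G * A₁ ^ 2 / ((q : ℝ) - 1) * (ℓ + W) +
      η * (6 * W + 6 + ℓ ^ 2)) * S := by
    have d1 : N 1 * A₁ ^ 2 * (ℓ + (W - V)) ≤ G * A₁ ^ 2 / ((q : ℝ) - 1) * S * (ℓ + W) :=
      mul_le_mul hκ (by linarith) (by linarith)
        (mul_nonneg (div_nonneg (mul_nonneg hG0 (sq_nonneg _)) hq1.le) hSpos.le)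
    have d2 : η * (2 * (2 * V + W + 3) + ℓ ^ 2) * S ≤ η * (6 * W + 6 + ℓ ^ 2) * S :=
      mul_le_mul_of_nonneg_right (mul_le_mul_of_nonneg_left (by linarith) hη0) hSpos.le
    linarith
  exact le_of_mul_le_mul_right hfin2 hSpos

end CharacterCone

namespace PrimeSums

/-- Partial summation over primes, for a weight vanishing at the end point. -/
lemma sum_primesLE_mul_log {F F' : ℝ → ℝ} {y : ℝ} (hy : 1 ≤ y)
    (hF : ∀ t ∈ Icc 1 y, HasDerivAt F (F' t) t) (hF' : ContinuousOn F' (Icc 1 y)) (h0 : F y = 0) :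
    IntervalIntegrable (fun t ↦ -F' t * Chebyshev.theta t) volume 1 y ∧
    ∑ p ∈ Nat.primesLE ⌊y⌋₊, F p * Real.log p = ∫ t in 1..y, -F' t * Chebyshev.theta t := by
  have hθ : ∀ t, ∑ k ∈ Finset.Icc 0 ⌊t⌋₊, (if k.Prime then Real.log k else 0) =
      Chebyshev.theta t := fun t ↦ by rw [Chebyshev.theta_eq_sum_Icc, Finset.sum_filter]
  have hd : ∀ t ∈ Icc 1 y, deriv F t = F' t := fun t ht ↦ (hF t ht).deriv
  have hintegrable : IntegrableOn (deriv F) (Icc 1 y) :=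
    (hF'.congr hd).integrableOn_compact isCompact_Icc
  have hintegrable' : IntegrableOn F' (Icc 1 y) := hF'.integrableOn_compact isCompact_Icc
  constructor
  · rw [intervalIntegrable_iff_integrableOn_Icc_of_le hy]
    have := integrableOn_mul_sum_Icc (m := 0) (fun k : ℕ ↦ if k.Prime then Real.log k else 0)
      zero_le_one (g := fun t ↦ -F' t) hintegrable'.neg
    simpa only [hθ] using this
  · have := sum_mul_eq_sub_integral_mul₀ (fun k : ℕ ↦ if k.Prime then Real.log k else 0)
      (by simp) y (fun t ht ↦ (hF t ht).differentiableAt) hintegrable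
    simp only [hθ, h0, zero_mul, zero_sub] at this
    rw [intervalIntegral.integral_of_le hy]
    simp only [neg_mul]
    rw [integral_neg]
    refine Eq.trans ?_ (this.trans ?_)
    · rw [Nat.primesLE_eq_filter_Icc_zero, Finset.sum_filter]
      refine Finset.sum_congr rfl fun p _ ↦ ?_
      split_ifs <;> simp
    · congr 1
      refine setIntegral_congr_fun measurableSet_Ioc fun t ht ↦ ?_
      simp only [hd t ⟨ht.1.le, ht.2⟩]

lemma exists_theta_bounds {ε : ℝ} (hε : 0 < ε) :
    ∃ T : ℝ, 0 ≤ T ∧ ∀ t, 0 ≤ t →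
      (1 - ε) * t - T ≤ Chebyshev.theta t ∧ Chebyshev.theta t ≤ (1 + ε) * t + T := by
  obtain ⟨K, hK⟩ := eventually_atTop.1 ((tendsto_theta_div.eventually
    (Metric.ball_mem_nhds (1:ℝ) hε)).and (eventually_gt_atTop 0))
  have hl : (0:ℝ) ≤ Real.log 4 := Real.log_nonneg (by norm_num)
  refine ⟨(1 + Real.log 4) * |K|, by positivity, fun t ht ↦ ?_⟩
  have h0 := Chebyshev.theta_nonneg t
  rcases le_or_gt K t with h | h
  · obtain ⟨h1, h2⟩ := hK t h
    rw [Real.dist_eq, abs_lt] at h1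
    have h3 : Chebyshev.theta t = Chebyshev.theta t / t * t := (div_mul_cancel₀ _ h2.ne').symm
    have h4 : 0 ≤ (1 + Real.log 4) * |K| := by positivity
    constructor <;> nlinarith
  · have h5 : t ≤ |K| := h.le.trans (le_abs_self K)
    have h6 := Chebyshev.theta_le_log4_mul_x ht
    constructor
    · nlinarith [mul_nonneg hl (abs_nonneg K), mul_nonneg hε.le ht]
    · nlinarith [mul_nonneg hε.le ht, abs_nonneg K]

variable {σ : ℝ}

/-- The resonating prime sum. -/
lemma sum_rpow_sub_mul_log_ge (hσ0 : 0 < σ) (hσ1 : σ < 1) {ε : ℝ} (hε : 0 < ε) :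
    ∀ᶠ y : ℝ in atTop, (1 - ε) * (σ / (1 - σ)) * y ^ (1 - σ) ≤
      ∑ p ∈ Nat.primesLE ⌊y⌋₊, ((p : ℝ) ^ (-σ) - y ^ (-σ)) * Real.log p := by
  obtain ⟨T, hT, hθ⟩ := exists_theta_bounds (half_pos hε)
  have hgrow : Tendsto (fun y : ℝ ↦ (ε / 2 * (σ / (1 - σ))) * y ^ (1 - σ)) atTop atTop :=
    (tendsto_rpow_atTop (by linarith)).const_mul_atTop
      (mul_pos (half_pos hε) (div_pos hσ0 (by linarith)))
  filter_upwards [hgrow.eventually_ge_atTop (|1 - ε / 2| * (σ / (1 - σ)) + T),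
    eventually_ge_atTop 1]
    with y hy hy1
  have hy0 : 0 < y := by linarith
  have hpos : ∀ t ∈ Icc 1 y, 0 < t := fun t ht ↦ by linarith [ht.1]
  obtain ⟨hi, he⟩ := sum_primesLE_mul_log (F := fun t ↦ t ^ (-σ) - y ^ (-σ))
    (F' := fun t ↦ -σ * t ^ (-σ - 1)) hy1
    (fun t ht ↦ (Real.hasDerivAt_rpow_const (Or.inl (hpos t ht).ne')).sub_const _)
    (continuousOn_const.mul (continuousOn_id.rpow_const fun t ht ↦ Or.inl (hpos t ht).ne'))
    (sub_self _)
  rw [he]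
  have hP : ∀ t ∈ Icc 1 y, HasDerivAt (fun t ↦ (1 - ε / 2) * (σ / (1 - σ)) * t ^ (1 - σ) +
      T * t ^ (-σ)) (σ * t ^ (-σ - 1) * ((1 - ε / 2) * t - T)) t := fun t ht ↦ by
    have h0 := hpos t ht
    have h1 : (1 - σ) ≠ 0 := by linarith
    refine (((Real.hasDerivAt_rpow_const (p := 1 - σ) (Or.inl h0.ne')).const_mul
      ((1 - ε / 2) * (σ / (1 - σ)))).add
      ((Real.hasDerivAt_rpow_const (p := -σ) (Or.inl h0.ne')).const_mul T)).congr_deriv ?_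
    have h2 : t ^ (1 - σ - 1) = t ^ (-σ - 1) * t := by
      rw [← Real.rpow_add_one h0.ne']; congr 1; ring
    rw [h2]
    field_simp
    ring
  have hintegrable :
      IntervalIntegrable (fun t ↦ σ * t ^ (-σ - 1) * ((1 - ε / 2) * t - T)) volume 1 y := by
    apply ContinuousOn.intervalIntegrable
    rw [uIcc_of_le hy1]
    exact (continuousOn_const.mul (continuousOn_id.rpow_const fun t ht ↦
      Or.inl (hpos t ht).ne')).mul (by fun_prop)
  have hle : ∫ t in 1..y, σ * t ^ (-σ - 1) * ((1 - ε / 2) * t - T) ≤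
      ∫ t in 1..y, -(-σ * t ^ (-σ - 1)) * Chebyshev.theta t := by
    refine intervalIntegral.integral_mono_on hy1 hintegrable hi fun t ht ↦ ?_
    rw [show -(-σ * t ^ (-σ - 1)) = σ * t ^ (-σ - 1) by ring]
    exact mul_le_mul_of_nonneg_left (hθ t (hpos t ht).le).1
      (mul_nonneg hσ0.le (Real.rpow_nonneg (hpos t ht).le _))
  rw [intervalIntegral.integral_eq_sub_of_hasDerivAt
    (by rw [uIcc_of_le hy1]; exact hP) hintegrable] at hle
  refine le_trans ?_ hle
  simp only [Real.one_rpow, mul_one]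
  have h3 : 0 ≤ T * y ^ (-σ) := mul_nonneg hT (Real.rpow_nonneg hy0.le _)
  have h4 : (1 - ε / 2) * (σ / (1 - σ)) ≤ |1 - ε / 2| * (σ / (1 - σ)) :=
    mul_le_mul_of_nonneg_right (le_abs_self _) (div_nonneg hσ0.le (by linarith))
  linarith

/-- The entropy cost of a prime at relative size `t`. -/
noncomputable def cost (σ t : ℝ) : ℝ := Real.log (2 - t ^ σ) - σ * Real.log t

lemma hasDerivAt_cost (hσ0 : 0 < σ) {t : ℝ} (ht0 : 0 < t) (ht1 : t ≤ 1) :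
    HasDerivAt (cost σ) (-(2 * σ / (t * (2 - t ^ σ)))) t := by
  have h1 : t ^ σ ≤ 1 := Real.rpow_le_one ht0.le ht1 hσ0.le
  have h2 : (2 - t ^ σ) ≠ 0 := by linarith
  refine ((((Real.hasDerivAt_rpow_const (p := σ) (Or.inl ht0.ne')).const_sub 2).log h2).sub
    ((Real.hasDerivAt_log ht0.ne').const_mul σ)).congr_deriv ?_
  rw [Real.rpow_sub_one ht0.ne']
  field_simp
  ring

lemma cost_nonneg (hσ0 : 0 < σ) {t : ℝ} (ht0 : 0 < t) (ht1 : t ≤ 1) : 0 ≤ cost σ t := by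
  have h1 : t ^ σ ≤ 1 := Real.rpow_le_one ht0.le ht1 hσ0.le
  have h2 : 0 ≤ Real.log (2 - t ^ σ) := Real.log_nonneg (by linarith)
  have h3 : Real.log t ≤ 0 := Real.log_nonpos ht0.le ht1
  rw [cost]
  nlinarith

lemma cost_le (hσ0 : 0 < σ) {t : ℝ} (ht0 : 0 < t) (ht1 : t ≤ 1) :
    cost σ t ≤ Real.log 2 - σ * Real.log t := by
  have h1 : t ^ σ ≤ 1 := Real.rpow_le_one ht0.le ht1 hσ0.le
  have h3 : 0 ≤ t ^ σ := Real.rpow_nonneg ht0.le σ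
  rw [cost]
  gcongr
  · linarith
  · linarith

lemma integral_two_div (hσ0 : 0 < σ) :
    ∫ t in (0:ℝ)..1, 2 * σ / (2 - t ^ σ) = σ * (1 + ∫ t in (0:ℝ)..1, t ^ σ / (2 - t ^ σ)) := by
  have hne : ∀ t ∈ Icc (0:ℝ) 1, 2 - t ^ σ ≠ 0 := fun t ht ↦ by
    have := Real.rpow_le_one ht.1 ht.2 hσ0.le
    linarith
  have hc : ContinuousOn (fun t : ℝ ↦ t ^ σ) (Icc 0 1) :=
    continuousOn_id.rpow_const fun t _ ↦ Or.inr hσ0.le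
  have hi : IntervalIntegrable (fun t : ℝ ↦ t ^ σ / (2 - t ^ σ)) volume 0 1 := by
    apply ContinuousOn.intervalIntegrable
    rw [uIcc_of_le zero_le_one]
    exact hc.div (continuousOn_const.sub hc) hne
  have h1 : (∫ t in (0:ℝ)..1, (1 + t ^ σ / (2 - t ^ σ))) =
      1 + ∫ t in (0:ℝ)..1, t ^ σ / (2 - t ^ σ) := by
    rw [intervalIntegral.integral_add intervalIntegrable_const hi]
    simp
  rw [← h1, ← intervalIntegral.integral_const_mul]
  refine intervalIntegral.integral_congr fun t ht ↦ ?_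
  rw [uIcc_of_le zero_le_one] at ht
  have := hne t ht
  field_simp
  ring

lemma integral_two_div_nonneg (hσ0 : 0 < σ) {a : ℝ} (ha : a ∈ Icc (0:ℝ) 1) :
    0 ≤ ∫ t in (0:ℝ)..a, 2 * σ / (2 - t ^ σ) :=
  intervalIntegral.integral_nonneg ha.1 fun t ht ↦ by
    have := Real.rpow_le_one ht.1 (ht.2.trans ha.2) hσ0.le
    exact div_nonneg (by linarith) (by linarith)

/-- The costs weighted by `log p` are controlled by partial summation. -/
lemma sum_cost_mul_log_le (hσ0 : 0 < σ) {y ε T : ℝ} (hy : 1 ≤ y) (hε : 0 ≤ 1 + ε)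
    (hθ : ∀ t, 0 ≤ t → Chebyshev.theta t ≤ (1 + ε) * t + T) :
    ∑ p ∈ Nat.primesLE ⌊y⌋₊, cost σ (p / y) * Real.log p ≤
      (1 + ε) * (∫ t in (0:ℝ)..1, 2 * σ / (2 - t ^ σ)) * y + T * cost σ (1 / y) := by
  have hy0 : 0 < y := by linarith
  have hpos : ∀ t ∈ Icc 1 y, 0 < t / y := fun t ht ↦ div_pos (by linarith [ht.1]) hy0
  have hle1 : ∀ t ∈ Icc 1 y, t / y ≤ 1 := fun t ht ↦ (div_le_one hy0).2 ht.2
  set k : ℝ → ℝ := fun t ↦ 2 * σ / (t * (2 - t ^ σ)) with hk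
  have hden : ∀ t : ℝ, 0 ≤ t → t ≤ 1 → 0 < 2 - t ^ σ := fun t h0 h1 ↦ by
    have := Real.rpow_le_one h0 h1 hσ0.le
    linarith
  have hderiv : ∀ t ∈ Icc 1 y, HasDerivAt (fun t ↦ cost σ (t / y)) (-k (t / y) * (1 / y)) t :=
    fun t ht ↦ HasDerivAt.comp (h := fun t ↦ t / y) t
      (hasDerivAt_cost hσ0 (hpos t ht) (hle1 t ht)) ((hasDerivAt_id' t).div_const y)
  have hdiv : ContinuousOn (fun t : ℝ ↦ t / y) (Icc 1 y) := by fun_prop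
  have hrp : ContinuousOn (fun t : ℝ ↦ (t / y) ^ σ) (Icc 1 y) :=
    hdiv.rpow_const fun t _ ↦ Or.inr hσ0.le
  have hkc : ContinuousOn (fun t ↦ -k (t / y) * (1 / y)) (Icc 1 y) := by
    refine ((continuousOn_const.div (hdiv.mul (continuousOn_const.sub hrp)) fun t ht ↦ ?_).neg).mul
      continuousOn_const
    exact (mul_pos (hpos t ht) (hden _ (hpos t ht).le (hle1 t ht))).ne'
  have hcost1 : cost σ (y / y) = 0 := by
    rw [div_self hy0.ne', cost, Real.one_rpow, Real.log_one]
    norm_num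
  obtain ⟨hi, he⟩ := sum_primesLE_mul_log hy hderiv hkc hcost1
  rw [he]
  set h : ℝ → ℝ := fun t ↦ 2 * σ / (2 - t ^ σ) with hh
  have hhc : ContinuousOn (fun t ↦ h (t / y)) (Icc 1 y) :=
    continuousOn_const.div (continuousOn_const.sub hrp) fun t ht ↦
      (hden _ (hpos t ht).le (hle1 t ht)).ne'
  have hhi : IntervalIntegrable (fun t ↦ h (t / y)) volume 1 y := by
    apply ContinuousOn.intervalIntegrable
    rwa [uIcc_of_le hy]
  have hki : IntervalIntegrable (fun t ↦ -k (t / y) * (1 / y)) volume 1 y := by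
    apply ContinuousOn.intervalIntegrable
    rwa [uIcc_of_le hy]
  have hh0 : IntervalIntegrable h volume 0 1 := by
    apply ContinuousOn.intervalIntegrable
    rw [uIcc_of_le zero_le_one]
    exact continuousOn_const.div (continuousOn_const.sub
      (continuousOn_id.rpow_const fun t _ ↦ Or.inr hσ0.le)) fun t ht ↦ (hden t ht.1 ht.2).ne'
  have hy1 : (1 / y) ∈ Icc (0:ℝ) 1 := ⟨by positivity, (div_le_one hy0).2 hy⟩
  have hIh : ∫ t in 1..y, h (t / y) ≤ y * ∫ t in (0:ℝ)..1, h t := by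
    rw [intervalIntegral.integral_comp_div h hy0.ne', div_self hy0.ne', smul_eq_mul]
    have h1 := intervalIntegral.integral_add_adjacent_intervals
      (hh0.mono_set (c := 0) (d := 1 / y)
        (by rw [uIcc_of_le zero_le_one, uIcc_of_le hy1.1]; exact Icc_subset_Icc_right hy1.2))
      (hh0.mono_set (c := 1 / y) (d := 1)
        (by rw [uIcc_of_le zero_le_one, uIcc_of_le hy1.2]; exact Icc_subset_Icc_left hy1.1))
    have h2 := integral_two_div_nonneg hσ0 hy1
    exact mul_le_mul_of_nonneg_left (by linarith) hy0.le
  have hIk : ∫ t in 1..y, -k (t / y) * (1 / y) = - cost σ (1 / y) := by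
    rw [intervalIntegral.integral_eq_sub_of_hasDerivAt (f := fun t ↦ cost σ (t / y))
      (by rw [uIcc_of_le hy]; exact hderiv) hki, hcost1, zero_sub]
  calc ∫ t in 1..y, -(-k (t / y) * (1 / y)) * Chebyshev.theta t
      ≤ ∫ t in 1..y, ((1 + ε) * h (t / y) - T * (-k (t / y) * (1 / y))) := by
        refine intervalIntegral.integral_mono_on hy hi
          ((hhi.const_mul _).sub (hki.const_mul _)) fun t ht ↦ ?_
        have ht0 : 0 < t := by linarith [ht.1]
        have hd := hden _ (hpos t ht).le (hle1 t ht)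
        have e1 : k (t / y) * (1 / y) * t = h (t / y) := by
          simp only [hk, hh]
          field_simp
        have h3 : 0 ≤ k (t / y) * (1 / y) := by
          have := hpos t ht
          simp only [hk]
          positivity
        have h4 := mul_le_mul_of_nonneg_left (hθ t ht0.le) h3
        rw [← e1]
        linarith
    _ = (1 + ε) * (∫ t in 1..y, h (t / y)) + T * cost σ (1 / y) := by
        rw [intervalIntegral.integral_sub (hhi.const_mul _) (hki.const_mul _),
          intervalIntegral.integral_const_mul, intervalIntegral.integral_const_mul, hIk]
        ring
    _ ≤ _ := by
        have := mul_le_mul_of_nonneg_left hIh hε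
        linarith

lemma tendsto_log_pow_mul_rpow_neg (k : ℕ) {δ : ℝ} (hδ : 0 < δ) :
    Tendsto (fun y : ℝ ↦ Real.log y ^ k * y ^ (-δ)) atTop (𝓝 0) := by
  have := (isLittleO_log_rpow_rpow_atTop (k : ℝ) hδ).tendsto_div_nhds_zero
  refine this.congr' ?_
  filter_upwards [eventually_ge_atTop 0] with y hy
  rw [Real.rpow_neg hy, Real.rpow_natCast, div_eq_mul_inv]

/-- The total cost of the resonator. -/
lemma sum_cost_le (hσ0 : 0 < σ) {ε : ℝ} (hε : 0 < ε) :
    ∀ᶠ y : ℝ in atTop, ∑ p ∈ Nat.primesLE ⌊y⌋₊, cost σ (p / y) ≤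
      ((σ * (1 + ∫ t in (0:ℝ)..1, t ^ σ / (2 - t ^ σ))) + ε) * (y / Real.log y) := by
  rw [← integral_two_div hσ0]
  set C := ∫ t in (0:ℝ)..1, 2 * σ / (2 - t ^ σ) with hC
  have hC0 : 0 ≤ C := integral_two_div_nonneg hσ0 ⟨zero_le_one, le_rfl⟩
  obtain ⟨δ, hδ0, hδ1, hδ⟩ : ∃ δ : ℝ, 0 < δ ∧ δ < 1 ∧ (1 + δ) * C / (1 - δ) < C + ε := by
    have h1 : Tendsto (fun δ : ℝ ↦ (1 + δ) * C / (1 - δ)) (𝓝[>] 0) (𝓝 ((1 + 0) * C / (1 - 0))) :=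
      (ContinuousAt.tendsto (by fun_prop (disch := norm_num))).mono_left nhdsWithin_le_nhds
    have h2 := h1.eventually_lt_const (u := C + ε) (by simp [hε])
    obtain ⟨δ, h3, h4, h5⟩ := (h2.and (Ioo_mem_nhdsGT (zero_lt_one' ℝ))).exists
    exact ⟨δ, h4, h5, h3⟩
  obtain ⟨T, hT, hθ⟩ := exists_theta_bounds hδ0
  have hlim : Tendsto (fun y : ℝ ↦ (Real.log 2 * (Real.log y ^ 1 * y ^ (-δ)) +
      σ * (Real.log y ^ 2 * y ^ (-δ))) + ((1 + δ) * C / (1 - δ) + T / (1 - δ) *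
      (Real.log 2 * (Real.log y ^ 0 * y ^ (-(1:ℝ))) + σ * (Real.log y ^ 1 * y ^ (-(1:ℝ))))))
      atTop (𝓝 ((Real.log 2 * 0 + σ * 0) +
        ((1 + δ) * C / (1 - δ) + T / (1 - δ) * (Real.log 2 * 0 + σ * 0)))) :=
    (((tendsto_log_pow_mul_rpow_neg 1 hδ0).const_mul _).add
      ((tendsto_log_pow_mul_rpow_neg 2 hδ0).const_mul _)).add (tendsto_const_nhds.add
      ((((tendsto_log_pow_mul_rpow_neg 0 one_pos).const_mul _).add
      ((tendsto_log_pow_mul_rpow_neg 1 one_pos).const_mul _)).const_mul _))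
  filter_upwards [hlim.eventually_lt_const (u := C + ε) (by simpa using hδ),
    eventually_gt_atTop 1] with y hy hy1
  have hy0 : 0 < y := by linarith
  have hl : 0 < Real.log y := Real.log_pos hy1
  have hl2 : 0 ≤ Real.log 2 := Real.log_nonneg (by norm_num)
  have hz0 : 0 < y ^ (1 - δ) := Real.rpow_pos_of_pos hy0 _
  have h1δ : 0 < 1 - δ := by linarith
  have hM0 : 0 ≤ Real.log 2 + σ * Real.log y := by positivity
  have hmem : ∀ p ∈ Nat.primesLE ⌊y⌋₊, p.Prime ∧ (p : ℝ) ≤ y := fun p hp ↦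
    ⟨Nat.prime_of_mem_primesLE hp, (Nat.le_floor_iff hy0.le).1 (Nat.le_of_mem_primesLE hp)⟩
  have hone : ∀ t : ℝ, 1 ≤ t → t ≤ y → cost σ (t / y) ≤ Real.log 2 + σ * Real.log y := by
    intro t h1 h2
    have h3 := cost_le hσ0 (t := t / y) (div_pos (by linarith) hy0) ((div_le_one hy0).2 h2)
    rw [Real.log_div (by linarith) hy0.ne'] at h3
    nlinarith [Real.log_nonneg h1]
  have hptw : ∀ p ∈ Nat.primesLE ⌊y⌋₊, cost σ (p / y) ≤
      (if (p : ℝ) ≤ y ^ (1 - δ) then Real.log 2 + σ * Real.log y else 0) +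
        cost σ (p / y) * Real.log p / ((1 - δ) * Real.log y) := by
    intro p hp
    obtain ⟨hpp, hpy⟩ := hmem p hp
    have hp1 : (1:ℝ) ≤ p := by exact_mod_cast hpp.one_le
    have hc0 := cost_nonneg hσ0 (t := p / y) (div_pos (by linarith) hy0) ((div_le_one hy0).2 hpy)
    split_ifs with h
    · have := hone p hp1 hpy
      have h2 : 0 ≤ cost σ (p / y) * Real.log p / ((1 - δ) * Real.log y) :=
        div_nonneg (mul_nonneg hc0 (Real.log_nonneg hp1)) (by positivity)
      linarith
    · rw [zero_add, le_div_iff₀ (by positivity)]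
      refine mul_le_mul_of_nonneg_left ?_ hc0
      rw [← Real.log_rpow hy0]
      exact Real.log_le_log hz0 (not_le.1 h).le
  have hcount : ∑ p ∈ Nat.primesLE ⌊y⌋₊,
      (if (p : ℝ) ≤ y ^ (1 - δ) then Real.log 2 + σ * Real.log y else 0) ≤
      y ^ (1 - δ) * (Real.log 2 + σ * Real.log y) := by
    rw [← Finset.sum_filter, Finset.sum_const, nsmul_eq_mul]
    refine mul_le_mul_of_nonneg_right ?_ hM0
    have hsub : (Nat.primesLE ⌊y⌋₊).filter (fun p : ℕ ↦ (p : ℝ) ≤ y ^ (1 - δ)) ⊆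
        Finset.Icc 1 ⌊y ^ (1 - δ)⌋₊ := fun p hp ↦ by
      obtain ⟨h1, h2⟩ := Finset.mem_filter.1 hp
      exact Finset.mem_Icc.2 ⟨(hmem p h1).1.one_le, Nat.le_floor h2⟩
    calc _ ≤ (((Finset.Icc 1 ⌊y ^ (1 - δ)⌋₊).card : ℕ) : ℝ) := by
          exact_mod_cast Finset.card_le_card hsub
      _ ≤ _ := by
          rw [Nat.card_Icc, Nat.add_sub_cancel]
          exact Nat.floor_le hz0.le
  have hS := sum_cost_mul_log_le hσ0 hy1.le (by linarith) fun t ht ↦ (hθ t ht).2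
  have hc1 := mul_le_mul_of_nonneg_left (hone 1 le_rfl hy1.le) hT
  calc _ ≤ _ := Finset.sum_le_sum hptw
    _ ≤ y ^ (1 - δ) * (Real.log 2 + σ * Real.log y) +
        ((1 + δ) * C * y + T * (Real.log 2 + σ * Real.log y)) / ((1 - δ) * Real.log y) := by
        rw [Finset.sum_add_distrib, ← Finset.sum_div]
        refine add_le_add hcount (div_le_div_of_nonneg_right ?_ (by positivity))
        linarith
    _ = ((Real.log 2 * (Real.log y ^ 1 * y ^ (-δ)) +
      σ * (Real.log y ^ 2 * y ^ (-δ))) + ((1 + δ) * C / (1 - δ) + T / (1 - δ) *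
      (Real.log 2 * (Real.log y ^ 0 * y ^ (-(1:ℝ))) + σ * (Real.log y ^ 1 * y ^ (-(1:ℝ)))))) *
        (y / Real.log y) := by
        have e1 : y ^ (1 - δ) = y * y ^ (-δ) := by
          rw [sub_eq_add_neg, Real.rpow_add hy0, Real.rpow_one]
        rw [e1, Real.rpow_neg_one]
        field_simp
    _ ≤ _ := mul_le_mul_of_nonneg_right hy.le (by positivity)

end PrimeSums

namespace CharacterCone

open DirichletCharacter PrimeSums

variable {q : ℕ} {σ : ℝ}

lemma charSum_rpow (χ : DirichletCharacter ℂ q) (N : ℕ) :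
    charSum (fun n ↦ (n : ℝ) ^ (-σ)) N χ = DirichletPartialSum.partialL χ N σ := by
  refine Finset.sum_congr rfl fun n _ ↦ ?_
  rw [Complex.ofReal_cpow n.cast_nonneg, mul_comm, Complex.ofReal_neg, Complex.ofReal_natCast]

lemma charSum_log_mul_rpow (χ : DirichletCharacter ℂ q) (N : ℕ) :
    charSum (fun n ↦ Real.log n * (n : ℝ) ^ (-σ)) N χ =
      ∑ n ∈ Finset.Icc 1 N, (Real.log n : ℂ) * χ n * (n : ℂ) ^ (-σ : ℂ) := by
  refine Finset.sum_congr rfl fun n _ ↦ ?_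
  rw [Complex.ofReal_mul, Complex.ofReal_cpow n.cast_nonneg, Complex.ofReal_neg,
    Complex.ofReal_natCast]
  ring

/-- An upper bound for `-Re (L' / L)` at the characters with `L ≠ 0` gives a bound without
division at all characters. -/
lemma re_neg_deriv_mul_star_le {L L' : ℂ} {V : ℝ} (h : L ≠ 0 → -((L' / L).re) ≤ V) :
    (-L' * star L).re ≤ V * ‖L‖ ^ 2 := by
  by_cases h0 : L = 0
  · simp [h0]
  · have h1 : -L' * star L = -(L' / L) * ((‖L‖ ^ 2 : ℝ) : ℂ) := by
      rw [Complex.ofReal_pow, ← Complex.mul_conj', Complex.star_def]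
      field_simp
    rw [h1, Complex.re_mul_ofReal, Complex.neg_re]
    exact mul_le_mul_of_nonneg_right (h h0) (by positivity)

lemma half_div_le_natCast_div {X p : ℕ} (hp : 0 < p) (hpX : p ≤ X) :
    (X : ℝ) / (2 * p) ≤ ((X / p : ℕ) : ℝ) := by
  have h1 : 1 ≤ X / p := (Nat.one_le_div_iff hp).2 hpX
  have h2 : X < p * (X / p + 1) := Nat.lt_mul_div_succ X hp
  have h3 : (X : ℝ) ≤ p * ((X / p : ℕ) + 1) := by exact_mod_cast h2.le
  have h4 : (1 : ℝ) ≤ ((X / p : ℕ) : ℝ) := by exact_mod_cast h1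
  have hp0 : (0 : ℝ) < p := by exact_mod_cast hp
  rw [div_le_iff₀ (by positivity)]
  nlinarith

/-- The resonance inequality for the logarithmic derivative, with the resonator supported on the
primes up to `y`. -/
lemma resonance_of_upper_bound [Fact q.Prime] (hσ0 : 0 < σ) (hσ1 : σ ≤ 1) {σ' : ℝ} (hσ' : 0 < σ')
    (hσσ' : σ' < σ) {y R η V : ℝ} (hyq : y < q) {X : ℕ} (hR : 1 ≤ R) (hX : 2 * y * R ≤ X)
    (hy : 1 ≤ y) (hV0 : 0 ≤ V) (hη1 : η ≤ 1)
    (hη : (2 + 4 / (σ' * (σ - σ'))) * (√q * (1 + Real.log q)) * R ^ (-σ') ≤ η)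
    (hV : ∀ χ : DirichletCharacter ℂ q, χ ≠ 1 → χ.LFunction σ ≠ 0 →
      -((deriv χ.LFunction σ / χ.LFunction σ).re) ≤ V)
    (hVW : V ≤ ∑ p ∈ Nat.primesLE ⌊y⌋₊, ((p : ℝ) ^ (-σ) - y ^ (-σ)) * Real.log p) :
    ∑ p ∈ Nat.primesLE ⌊y⌋₊, ((p : ℝ) ^ (-σ) - y ^ (-σ)) * Real.log p - V ≤
      Real.exp (∑ p ∈ Nat.primesLE ⌊y⌋₊, cost σ (p / y)) *
        (∑ n ∈ Finset.Icc 1 X, (n : ℝ) ^ (-σ)) ^ 2 / ((q : ℝ) - 1) *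
        (Real.log X + ∑ p ∈ Nat.primesLE ⌊y⌋₊, ((p : ℝ) ^ (-σ) - y ^ (-σ)) * Real.log p) +
      η * (6 * ∑ p ∈ Nat.primesLE ⌊y⌋₊, ((p : ℝ) ^ (-σ) - y ^ (-σ)) * Real.log p + 6 +
        Real.log X ^ 2) := by
  have hy0 : 0 < y := by linarith
  have hq1 : (1 : ℝ) ≤ q := by exact_mod_cast (Fact.out : q.Prime).one_le
  set P : ℝ := √q * (1 + Real.log q) with hPdef
  have hP0 : 0 ≤ P := mul_nonneg (Real.sqrt_nonneg _) (by linarith [Real.log_nonneg hq1])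
  have hR0 : 0 < R := by linarith
  have hRp : 0 ≤ R ^ (-σ') := Real.rpow_nonneg hR0.le _
  have hc0 : 0 ≤ 4 / (σ' * (σ - σ')) := div_nonneg (by norm_num)
    (mul_nonneg hσ'.le (by linarith))
  have hη0 : 0 ≤ η := le_trans (by positivity) hη
  have hRy : R ≤ 2 * y * R := by nlinarith
  have hRX : R ≤ X := hRy.trans hX
  have hyX : y ≤ X := by nlinarith
  have hX1 : 1 ≤ X := by exact_mod_cast hy.trans hyX
  have hmem : ∀ p ∈ Nat.primesLE ⌊y⌋₊, p.Prime ∧ (p : ℝ) ≤ y := fun p hp ↦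
    ⟨Nat.prime_of_mem_primesLE hp, (Nat.le_floor_iff hy0.le).1 (Nat.le_of_mem_primesLE hp)⟩
  have hpos : ∀ p ∈ Nat.primesLE ⌊y⌋₊, (0:ℝ) < p := fun p hp ↦ by
    exact_mod_cast (hmem p hp).1.pos
  have hdiv : ∀ p ∈ Nat.primesLE ⌊y⌋₊, 0 < (p : ℝ) / y ∧ (p : ℝ) / y ≤ 1 := fun p hp ↦
    ⟨div_pos (hpos p hp) hy0, (div_le_one hy0).2 (hmem p hp).2⟩
  have hrp : ∀ p ∈ Nat.primesLE ⌊y⌋₊, 0 < ((p : ℝ) / y) ^ σ ∧ ((p : ℝ) / y) ^ σ ≤ 1 := fun p hp ↦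
    ⟨Real.rpow_pos_of_pos (hdiv p hp).1 _, Real.rpow_le_one (hdiv p hp).1.le (hdiv p hp).2 hσ0.le⟩
  have hw : ∑ p ∈ Nat.primesLE ⌊y⌋₊, (1 - ((p : ℝ) / y) ^ σ) * (Real.log p * (p : ℝ) ^ (-σ)) =
      ∑ p ∈ Nat.primesLE ⌊y⌋₊, ((p : ℝ) ^ (-σ) - y ^ (-σ)) * Real.log p := by
    refine Finset.sum_congr rfl fun p hp ↦ ?_
    have h1 := Real.rpow_pos_of_pos (hpos p hp) σ
    have h2 := Real.rpow_pos_of_pos hy0 σ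
    rw [Real.div_rpow (hpos p hp).le hy0.le, Real.rpow_neg (hpos p hp).le, Real.rpow_neg hy0.le]
    field_simp
  have hprod : ∏ p ∈ Nat.primesLE ⌊y⌋₊, (1 + (1 - ((p : ℝ) / y) ^ σ)) /
      (1 - (1 - ((p : ℝ) / y) ^ σ)) = Real.exp (∑ p ∈ Nat.primesLE ⌊y⌋₊, cost σ (p / y)) := by
    rw [Real.exp_sum]
    refine Finset.prod_congr rfl fun p hp ↦ ?_
    obtain ⟨h1, h2⟩ := hrp p hp
    rw [cost, ← Real.log_rpow (hdiv p hp).1, Real.exp_sub, Real.exp_log (by linarith),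
      Real.exp_log h1]
    ring
  have hPV : ∀ χ : DirichletCharacter ℂ q, χ ≠ 1 → ∀ N : ℕ, ‖∑ n ∈ Finset.Icc 1 N, χ n‖ ≤ P :=
    fun χ hχ N ↦ PolyaVinogradov.norm_sum_le hχ N
  have hLN : ∀ χ : DirichletCharacter ℂ q, χ ≠ 1 → ∀ N : ℕ, R ≤ N →
      ‖χ.LFunction σ - charSum (fun n ↦ (n : ℝ) ^ (-σ)) N χ‖ ≤ η := by
    intro χ hχ N hN
    have hN1 : 1 ≤ N := by exact_mod_cast hR.trans hN
    rw [charSum_rpow]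
    have h1 := DirichletPartialSum.norm_LFunction_sub_partialL_le hχ (hPV χ hχ)
      (s := (σ : ℂ)) (by simpa using hσ0) hN1
    have h2 : ‖(σ : ℂ)‖ / (σ : ℂ).re = 1 := by
      rw [Complex.norm_real, Real.norm_of_nonneg hσ0.le, Complex.ofReal_re, div_self hσ0.ne']
    rw [h2, mul_one, Complex.ofReal_re] at h1
    have h3 : (N : ℝ) ^ (-σ) ≤ R ^ (-σ') :=
      (Real.rpow_le_rpow_of_exponent_le (hR.trans hN) (by linarith)).trans
        (Real.rpow_le_rpow_of_nonpos hR0 hN (by linarith))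
    refine h1.trans (le_trans ?_ hη)
    calc 2 * P * (N : ℝ) ^ (-σ) ≤ 2 * P * R ^ (-σ') :=
          mul_le_mul_of_nonneg_left h3 (by positivity)
      _ ≤ _ := by
          refine mul_le_mul_of_nonneg_right (mul_le_mul_of_nonneg_right ?_ hP0) hRp
          linarith
  have key := resonance_inequality (q := q) (g := fun n ↦ (n : ℝ) ^ (-σ))
    (fun n ↦ Real.rpow_nonneg n.cast_nonneg _) (by simp)
    (fun m n ↦ by rw [Nat.cast_mul, Real.mul_rpow m.cast_nonneg n.cast_nonneg])
    (s := Nat.primesLE ⌊y⌋₊) (fun p hp ↦ (hmem p hp).1)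
    (fun p hp h ↦ by
      have h1 := Nat.le_of_dvd (hmem p hp).1.pos ((ZMod.natCast_eq_zero_iff p q).1 h)
      have h2 : (q : ℝ) ≤ p := by exact_mod_cast h1
      linarith [(hmem p hp).2])
    (r := fun p ↦ 1 - ((p : ℝ) / y) ^ σ) (fun p hp ↦ by linarith [(hrp p hp).2])
    (fun p hp ↦ by linarith [(hrp p hp).1]) hX1 hV0 hη0 hη1
    (L := fun χ ↦ χ.LFunction σ) (D := fun χ ↦ -deriv χ.LFunction σ)
    (fun χ hχ ↦ re_neg_deriv_mul_star_le (hV χ hχ)) (fun χ hχ ↦ hLN χ hχ X hRX)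
    (fun χ hχ p hp ↦ hLN χ hχ _ (by
      have h1 : p ≤ X := by exact_mod_cast (hmem p hp).2.trans hyX
      refine le_trans ?_ (half_div_le_natCast_div (hmem p hp).1.pos h1)
      rw [le_div_iff₀ (by linarith [hpos p hp])]
      nlinarith [(hmem p hp).2]))
    (fun χ hχ ↦ by
      rw [charSum_log_mul_rpow]
      refine (DirichletPartialSum.norm_deriv_LFunction_sub_le hχ (hPV χ hχ) hσ' hσσ' hσ1 hX1).trans
        (le_trans ?_ hη)
      have h3 : (X : ℝ) ^ (-σ') ≤ R ^ (-σ') := Real.rpow_le_rpow_of_nonpos hR0 hRX (by linarith)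
      calc 4 * P / (σ' * (σ - σ')) * (X : ℝ) ^ (-σ') =
            4 / (σ' * (σ - σ')) * P * (X : ℝ) ^ (-σ') := by
            ring
        _ ≤ 4 / (σ' * (σ - σ')) * P * R ^ (-σ') :=
            mul_le_mul_of_nonneg_left h3 (by positivity)
        _ ≤ _ := by
          refine mul_le_mul_of_nonneg_right (mul_le_mul_of_nonneg_right ?_ hP0) hRp
          linarith)
    (by simpa only [hw] using hVW)
  simpa only [hw, hprod] using key

lemma sum_rpow_neg_le (hσ0 : 0 < σ) (hσ1 : σ < 1) (X : ℕ) :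
    ∑ n ∈ Finset.Icc 1 X, (n : ℝ) ^ (-σ) ≤ (X : ℝ) ^ (1 - σ) / (1 - σ) := by
  induction X with
  | zero => simp [Real.zero_rpow (by linarith : 1 - σ ≠ 0)]
  | succ X ih =>
    rw [Finset.sum_Icc_succ_top (by lia)]
    have h1σ : 0 < 1 - σ := by linarith
    have h0 : (0:ℝ) < X + 1 := by positivity
    have h1 : (1 + (-1 / ((X : ℝ) + 1))) ^ (1 - σ) ≤ 1 + (1 - σ) * (-1 / ((X : ℝ) + 1)) := by
      refine rpow_one_add_le_one_add_mul_self ?_ h1σ.le (by linarith)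
      rw [le_div_iff₀ h0]
      linarith [(Nat.cast_nonneg X : (0:ℝ) ≤ X)]
    have h2 : (1 + (-1 / ((X : ℝ) + 1))) = X / (X + 1) := by field_simp; ring
    rw [h2, Real.div_rpow X.cast_nonneg h0.le, div_le_iff₀ (Real.rpow_pos_of_pos h0 _)] at h1
    have h3 : ((X : ℝ) + 1) ^ (1 - σ) = ((X : ℝ) + 1) ^ (-σ) * (X + 1) := by
      rw [← Real.rpow_add_one h0.ne']; congr 1; ring
    have h4 : (1 + (1 - σ) * (-1 / ((X : ℝ) + 1))) * ((X : ℝ) + 1) ^ (1 - σ) =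
        ((X : ℝ) + 1) ^ (1 - σ) - (1 - σ) * ((X : ℝ) + 1) ^ (-σ) := by
      rw [h3]; field_simp
      ring
    rw [h4] at h1
    rw [le_div_iff₀ h1σ] at ih ⊢
    push_cast
    linarith

end CharacterCone

namespace LargeValues

open PrimeSums

variable {σ : ℝ}

/-- Choice of the parameters of the resonance argument. -/
lemma exists_parameters (hσ : σ ∈ Ioo (1/2 : ℝ) 1) {c C : ℝ} (hC : 0 < C)
    (hc : c < σ / (1 - σ) *
      ((1 - min (3 * (1 - σ) / (2 - σ)) (2 * (1 - σ) / σ)) / C) ^ (1 - σ)) :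
    ∃ α ε x σ' : ℝ, 0 < α ∧ 0 < ε ∧ 0 < x ∧ 0 < σ' ∧ σ' < σ ∧ 1 / 2 < x * σ' ∧
      (C + ε) * α + 2 * x * (1 - σ) < 1 ∧ c < (1 - ε) * (σ / (1 - σ)) * α ^ (1 - σ) := by
  obtain ⟨hσ0, hσ1⟩ := hσ
  have hσp : 0 < σ := by linarith
  have h1σ : 0 < 1 - σ := by linarith
  set κ := 1 - min (3 * (1 - σ) / (2 - σ)) (2 * (1 - σ) / σ) with hκ
  have hκ0 : 0 < κ := by
    have h1 : 3 * (1 - σ) / (2 - σ) < 1 := by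
      rw [div_lt_one (by linarith)]; linarith
    linarith [min_le_left (3 * (1 - σ) / (2 - σ)) (2 * (1 - σ) / σ)]
  have hκ1 : κ ≤ 1 - (1 - σ) / σ := by
    have h1 : (1 - σ) / σ ≤ min (3 * (1 - σ) / (2 - σ)) (2 * (1 - σ) / σ) := by
      refine le_min ?_ ?_
      · rw [div_le_div_iff₀ hσp (by linarith)]
        nlinarith
      · exact div_le_div_of_nonneg_right (by linarith) hσp.le
    linarith
  obtain ⟨δ, hδ0, hδ1, hδ⟩ : ∃ δ : ℝ, 0 < δ ∧ δ < 1 ∧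
      c < (1 - δ) * (σ / (1 - σ)) * ((1 - δ) * (κ / C)) ^ (1 - σ) := by
    have h1 : Tendsto (fun δ : ℝ ↦ (1 - δ) * (σ / (1 - σ)) * ((1 - δ) * (κ / C)) ^ (1 - σ))
        (𝓝[>] 0) (𝓝 ((1 - 0) * (σ / (1 - σ)) * ((1 - 0) * (κ / C)) ^ (1 - σ))) := by
      refine (ContinuousAt.tendsto ?_).mono_left nhdsWithin_le_nhds
      refine ContinuousAt.mul (by fun_prop) (ContinuousAt.rpow_const (by fun_prop) (Or.inr h1σ.le))
    have h2 := h1.eventually_const_lt (u := c) (by simpa using hc)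
    obtain ⟨δ, h3, h4, h5⟩ := (h2.and (Ioo_mem_nhdsGT (zero_lt_one' ℝ))).exists
    exact ⟨δ, h4, h5, h3⟩
  have hα : 0 < (1 - δ) * (κ / C) := mul_pos (by linarith) (div_pos hκ0 hC)
  have hCε : (C + min δ (δ * C / 2)) * ((1 - δ) * (κ / C)) < κ := by
    have h1 : min δ (δ * C / 2) ≤ δ * C / 2 := min_le_right _ _
    calc _ ≤ (C + δ * C / 2) * ((1 - δ) * (κ / C)) :=
          mul_le_mul_of_nonneg_right (by linarith) hα.le
      _ = (1 - δ / 2 - δ ^ 2 / 2) * κ := by field_simp; ring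
      _ < _ := by nlinarith [mul_pos hδ0 hκ0, mul_pos (pow_pos hδ0 2) hκ0]
  obtain ⟨x, hx1, hx2⟩ := exists_between (a₁ := 1 / (2 * σ))
    (a₂ := (1 - (C + min δ (δ * C / 2)) * ((1 - δ) * (κ / C))) / (2 * (1 - σ))) (by
      rw [lt_div_iff₀ (by linarith)]
      have : 1 / (2 * σ) * (2 * (1 - σ)) = (1 - σ) / σ := by field_simp
      linarith)
  have hx0 : 0 < x := lt_trans (by positivity) hx1
  obtain ⟨σ', h1, h2⟩ := exists_between (a₁ := 1 / (2 * x)) (a₂ := σ) (by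
    rw [div_lt_iff₀ (by positivity)] at hx1 ⊢
    linarith)
  refine ⟨(1 - δ) * (κ / C), min δ (δ * C / 2), x, σ', hα, lt_min hδ0 (by positivity), hx0,
    lt_trans (by positivity) h1, h2, ?_, ?_, ?_⟩
  · rw [div_lt_iff₀ (by positivity)] at h1
    linarith
  · rw [lt_div_iff₀ (by linarith)] at hx2
    linarith
  · refine hδ.trans_le (mul_le_mul_of_nonneg_right (mul_le_mul_of_nonneg_right ?_
      (div_nonneg hσp.le h1σ.le)) (Real.rpow_nonneg hα.le _))
    linarith [min_le_left δ (δ * C / 2)]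

lemma tendsto_length {α : ℝ} (hα : 0 < α) :
    Tendsto (fun t : ℝ ↦ α * Real.log t * Real.log (Real.log t)) atTop atTop :=
  (Real.tendsto_log_atTop.const_mul_atTop hα).atTop_mul_atTop₀
    (Real.tendsto_log_atTop.comp Real.tendsto_log_atTop)

/-- The length `y = α log t log log t` satisfies `y / log y ≤ α log t` for large `t`. -/
lemma eventually_length_div_log_le {α : ℝ} (hα : 0 < α) :
    ∀ᶠ t : ℝ in atTop, α * Real.log t * Real.log (Real.log t) /
      Real.log (α * Real.log t * Real.log (Real.log t)) ≤ α * Real.log t := by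
  have h2 : Tendsto (fun t : ℝ ↦ Real.log (Real.log t)) atTop atTop :=
    Real.tendsto_log_atTop.comp Real.tendsto_log_atTop
  filter_upwards [Real.tendsto_log_atTop.eventually_gt_atTop 0, h2.eventually_gt_atTop 0,
    (h2.const_mul_atTop hα).eventually_ge_atTop 1] with t ht1 ht2 ht3
  have h3 : Real.log (Real.log t) ≤ Real.log (α * Real.log t * Real.log (Real.log t)) :=
    Real.log_le_log ht1 (by nlinarith)
  rw [div_le_iff₀ (ht2.trans_le h3)]
  exact mul_le_mul_of_nonneg_left h3 (by positivity)

lemma eventually_length_le_log_sq {α : ℝ} (hα : 0 < α) :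
    ∀ᶠ t : ℝ in atTop, α * Real.log t * Real.log (Real.log t) ≤ Real.log t ^ 2 := by
  have h1 : Tendsto (fun u : ℝ ↦ Real.log u / u) atTop (𝓝 0) := by
    simpa using Real.isLittleO_log_id_atTop.tendsto_div_nhds_zero
  have h2 := (h1.comp Real.tendsto_log_atTop).eventually_lt_const (u := α⁻¹) (by positivity)
  filter_upwards [h2, Real.tendsto_log_atTop.eventually_gt_atTop 0] with t ht1 ht2
  simp only [Function.comp] at ht1
  rw [div_lt_iff₀ ht2, inv_mul_eq_div, lt_div_iff₀ hα] at ht1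
  nlinarith

lemma sum_rpow_sub_mul_log_le (hσ0 : 0 < σ) {y : ℝ} (hy : 1 ≤ y) :
    ∑ p ∈ Nat.primesLE ⌊y⌋₊, ((p : ℝ) ^ (-σ) - y ^ (-σ)) * Real.log p ≤ 2 * y := by
  have h4 : Real.log 4 ≤ 2 := by
    rw [show (4:ℝ) = 2 ^ 2 by norm_num, Real.log_pow]
    have := Real.log_two_lt_d9
    push_cast
    linarith
  calc _ ≤ ∑ p ∈ Nat.primesLE ⌊y⌋₊, Real.log p := by
        refine Finset.sum_le_sum fun p hp ↦ ?_
        have hp1 : (1:ℝ) ≤ p := by exact_mod_cast (Nat.prime_of_mem_primesLE hp).one_le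
        have h1 : (p : ℝ) ^ (-σ) ≤ 1 := Real.rpow_le_one_of_one_le_of_nonpos hp1 (by linarith)
        have h2 : 0 ≤ y ^ (-σ) := Real.rpow_nonneg (by linarith) _
        nlinarith [Real.log_nonneg hp1]
    _ = Chebyshev.theta y := (Chebyshev.theta_eq_sum_primesLE y).symm
    _ ≤ Real.log 4 * y := Chebyshev.theta_le_log4_mul_x (by linarith)
    _ ≤ _ := mul_le_mul_of_nonneg_right h4 (by linarith)

/-- The first error term of the resonance inequality. -/
lemma main_term_le (hσ0 : 0 < σ) (hσ1 : σ < 1) {t x κ E W : ℝ} (ht : 2 ≤ t) (hx : 0 < x)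
    (hE : E ≤ κ * Real.log t)
    (hW0 : 0 ≤ W) (hW : W ≤ 2 * Real.log t ^ 2) (hX : Real.log ⌈t ^ x⌉₊ ≤ Real.log t ^ 2) :
    Real.exp E * (∑ n ∈ Finset.Icc 1 ⌈t ^ x⌉₊, (n : ℝ) ^ (-σ)) ^ 2 / (t - 1) *
      (Real.log ⌈t ^ x⌉₊ + W) ≤
      24 / (1 - σ) ^ 2 * (Real.log t ^ 2 * t ^ (-(1 - (κ + 2 * x * (1 - σ))))) := by
  have ht0 : 0 < t := by linarith
  have h1σ : 0 < 1 - σ := by linarith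
  have h1 : Real.exp E ≤ t ^ κ := by
    rw [Real.rpow_def_of_pos ht0, mul_comm]
    exact Real.exp_le_exp.2 hE
  have hx1 : 1 ≤ t ^ x := Real.one_le_rpow (by linarith) hx.le
  have hX2 : ((⌈t ^ x⌉₊ : ℕ) : ℝ) ≤ 2 * t ^ x := by
    have := Nat.ceil_lt_add_one (zero_le_one.trans hx1)
    linarith
  have h2 : ∑ n ∈ Finset.Icc 1 ⌈t ^ x⌉₊, (n : ℝ) ^ (-σ) ≤ 2 * t ^ (x * (1 - σ)) / (1 - σ) := by
    refine (CharacterCone.sum_rpow_neg_le hσ0 hσ1 _).trans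
      (div_le_div_of_nonneg_right ?_ h1σ.le)
    calc _ ≤ (2 * t ^ x) ^ (1 - σ) := Real.rpow_le_rpow (Nat.cast_nonneg _) hX2 h1σ.le
      _ = 2 ^ (1 - σ) * t ^ (x * (1 - σ)) := by
          rw [Real.mul_rpow (by norm_num) (by positivity), ← Real.rpow_mul ht0.le]
      _ ≤ _ := by
          refine mul_le_mul_of_nonneg_right ?_ (by positivity)
          calc (2:ℝ) ^ (1 - σ) ≤ 2 ^ (1:ℝ) :=
                Real.rpow_le_rpow_of_exponent_le (by norm_num) (by linarith)
            _ = 2 := Real.rpow_one 2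
  have h3 : 0 ≤ ∑ n ∈ Finset.Icc 1 ⌈t ^ x⌉₊, (n : ℝ) ^ (-σ) :=
    Finset.sum_nonneg fun n _ ↦ Real.rpow_nonneg n.cast_nonneg _
  have h4 : t / 2 ≤ t - 1 := by linarith
  have h5 : 0 ≤ Real.log ⌈t ^ x⌉₊ := Real.log_natCast_nonneg _
  calc _ ≤ t ^ κ * (2 * t ^ (x * (1 - σ)) / (1 - σ)) ^ 2 / (t / 2) * (3 * Real.log t ^ 2) := by
        gcongr
        linarith
    _ = 24 / (1 - σ) ^ 2 *
        (Real.log t ^ 2 * (t ^ κ * (t ^ (x * (1 - σ)) * t ^ (x * (1 - σ))) * t ^ (-1 : ℝ))) := by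
        rw [Real.rpow_neg_one]
        field_simp
        ring
    _ = _ := by
        rw [← Real.rpow_add ht0, ← Real.rpow_add ht0, ← Real.rpow_add ht0]
        congr 3
        ring

/-- The truncation error. -/
lemma truncation_le {t x σ' y K : ℝ} (ht : 1 ≤ Real.log t) (ht1 : 1 ≤ t) (hK : 0 ≤ K) (hy : 1 ≤ y)
    (hyt : y ≤ Real.log t ^ 2) (hσ'1 : σ' ≤ 1) :
    K * (√t * (1 + Real.log t)) * (t ^ x / (2 * y)) ^ (-σ') ≤
      4 * K * (Real.log t ^ 3 * t ^ (-(x * σ' - 1 / 2))) := by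
  have ht0 : 0 < t := by linarith
  have h1 : (t ^ x / (2 * y)) ^ (-σ') ≤ t ^ (-(x * σ')) * (2 * Real.log t ^ 2) := by
    rw [Real.div_rpow (by positivity) (by positivity), ← Real.rpow_mul ht0.le, mul_neg,
      Real.rpow_neg (by positivity : 0 ≤ 2 * y), div_inv_eq_mul]
    refine mul_le_mul_of_nonneg_left ?_ (by positivity)
    calc (2 * y) ^ σ' ≤ (2 * y) ^ (1:ℝ) := Real.rpow_le_rpow_of_exponent_le (by linarith) hσ'1
      _ = 2 * y := Real.rpow_one _
      _ ≤ _ := by linarith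
  calc _ ≤ K * (√t * (2 * Real.log t)) * (t ^ (-(x * σ')) * (2 * Real.log t ^ 2)) := by
        gcongr
        linarith
    _ = 4 * K * (Real.log t ^ 3 * (t ^ (1 / 2 : ℝ) * t ^ (-(x * σ')))) := by
        rw [← Real.sqrt_eq_rpow]
        ring
    _ = _ := by
        rw [← Real.rpow_add ht0]
        congr 3
        ring

end LargeValues

/-- For fixed `σ ∈ (1/2, 1)`, with
`ϑ(σ) = min(3(1-σ)/(2-σ), 2(1-σ)/σ)` and `λ(σ) = ∫₀¹ t^σ/(2 - t^σ) dt`: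
for every `0 < c < (σ/(1-σ)) ((1 - ϑ(σ))/(σ(1 + λ(σ))))^{1-σ}` and all sufficiently large
primes `q` there is a non-principal Dirichlet character `χ` mod `q` with `L(σ, χ) ≠ 0` and
`-Re(L'(σ,χ)/L(σ,χ)) ≥ c (log q)^{1-σ} (log log q)^{1-σ}`. -/
theorem large_values_of_log_derivative_explicit_constant (σ : ℝ)
    (hσ : σ ∈ Set.Ioo (1/2 : ℝ) 1) (c : ℝ) (hc0 : 0 < c)
    (hc : c < σ / (1 - σ) *
        ((1 - min (3 * (1 - σ) / (2 - σ)) (2 * (1 - σ) / σ)) /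
          (σ * (1 + ∫ t in (0:ℝ)..1, t ^ σ / (2 - t ^ σ)))) ^ (1 - σ)) :
    ∃ Q : ℕ, ∀ (q : ℕ) [NeZero q], q.Prime → Q ≤ q →
      ∃ χ : DirichletCharacter ℂ q, χ ≠ 1 ∧
        DirichletCharacter.LFunction χ (σ : ℂ) ≠ 0 ∧
        c * (Real.log q) ^ (1 - σ) * (Real.log (Real.log q)) ^ (1 - σ) ≤
          -((deriv (DirichletCharacter.LFunction χ) (σ : ℂ) /
              DirichletCharacter.LFunction χ (σ : ℂ)).re) := by
  have hσ0 : 0 < σ := by linarith [hσ.1]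
  have hσ1 : σ < 1 := hσ.2
  have h1σ : 0 < 1 - σ := by linarith
  set C := σ * (1 + ∫ t in (0:ℝ)..1, t ^ σ / (2 - t ^ σ)) with hC
  have hCpos : 0 < C := by
    refine mul_pos hσ0 ?_
    have : 0 ≤ ∫ t in (0:ℝ)..1, t ^ σ / (2 - t ^ σ) :=
      intervalIntegral.integral_nonneg zero_le_one fun t ht ↦ by
        have := Real.rpow_le_one ht.1 ht.2 hσ0.le
        exact div_nonneg (Real.rpow_nonneg ht.1 _) (by linarith)
    linarith
  obtain ⟨α, ε, x, σ', hα, hε, hx, hσ'0, hσ'σ, hxσ', hexp, hcα⟩ :=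
    LargeValues.exists_parameters hσ hCpos hc
  set K : ℝ := 2 + 4 / (σ' * (σ - σ')) with hK
  have hK0 : 0 ≤ K := add_nonneg (by norm_num)
    (div_nonneg (by norm_num) (mul_nonneg hσ'0.le (by linarith)))
  have hy := LargeValues.tendsto_length hα
  have hT1 : Tendsto (fun t : ℝ ↦ 24 / (1 - σ) ^ 2 *
      (Real.log t ^ 2 * t ^ (-(1 - ((C + ε) * α + 2 * x * (1 - σ)))))) atTop (𝓝 (_ * 0)) :=
    (PrimeSums.tendsto_log_pow_mul_rpow_neg 2 (by linarith)).const_mul _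
  have hT2 : Tendsto (fun t : ℝ ↦ 4 * K * (Real.log t ^ 3 * t ^ (-(x * σ' - 1 / 2))))
      atTop (𝓝 (_ * 0)) :=
    (PrimeSums.tendsto_log_pow_mul_rpow_neg 3 (by linarith)).const_mul _
  have hT3 : Tendsto (fun t : ℝ ↦ 76 * K * (Real.log t ^ 7 * t ^ (-(x * σ' - 1 / 2))))
      atTop (𝓝 (_ * 0)) :=
    (PrimeSums.tendsto_log_pow_mul_rpow_neg 7 (by linarith)).const_mul _
  rw [mul_zero] at hT1 hT2 hT3
  have hgrow : Tendsto (fun t : ℝ ↦ ((1 - ε) * (σ / (1 - σ)) * α ^ (1 - σ) - c) *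
      (Real.log t ^ (1 - σ) * Real.log (Real.log t) ^ (1 - σ))) atTop atTop :=
    (((tendsto_rpow_atTop h1σ).comp Real.tendsto_log_atTop).atTop_mul_atTop₀
      ((tendsto_rpow_atTop h1σ).comp (Real.tendsto_log_atTop.comp
        Real.tendsto_log_atTop))).const_mul_atTop (by linarith)
  have hlarge : ∀ᶠ t : ℝ in atTop, 2 * Real.log t ^ 2 ≤ t ^ x ∧ Real.log t ^ 2 < t := by
    have h1 := (PrimeSums.tendsto_log_pow_mul_rpow_neg 2 hx).eventually_lt_const
      (u := 1 / 2) (by norm_num)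
    have h2 := (PrimeSums.tendsto_log_pow_mul_rpow_neg 2 one_pos).eventually_lt_const
      (u := 1) (by norm_num)
    filter_upwards [h1, h2, eventually_gt_atTop 0] with t h1 h2 ht
    rw [Real.rpow_neg ht.le, ← div_eq_mul_inv, div_lt_iff₀ (by positivity)] at h1 h2
    rw [Real.rpow_one] at h2
    constructor <;> linarith
  have hcost := PrimeSums.sum_cost_le hσ0 hε
  rw [← hC] at hcost
  have hmain : ∀ᶠ t : ℝ in atTop, ∀ (q : ℕ) [NeZero q], (q : ℝ) = t → q.Prime →
      ∃ χ : DirichletCharacter ℂ q, χ ≠ 1 ∧ DirichletCharacter.LFunction χ (σ : ℂ) ≠ 0 ∧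
      c * (Real.log q) ^ (1 - σ) * (Real.log (Real.log q)) ^ (1 - σ) ≤
        -((deriv (DirichletCharacter.LFunction χ) (σ : ℂ) /
          DirichletCharacter.LFunction χ (σ : ℂ)).re) := by
    filter_upwards [hy.eventually (PrimeSums.sum_rpow_sub_mul_log_ge hσ0 hσ1 hε),
      hy.eventually hcost, hy.eventually_ge_atTop 1,
      LargeValues.eventually_length_div_log_le hα, LargeValues.eventually_length_le_log_sq hα,
      hT1.eventually_lt_const (u := 1 / 2) (by norm_num),
      hT2.eventually_lt_const (u := 1) (by norm_num),
      hT3.eventually_lt_const (u := 1 / 2) (by norm_num),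
      hgrow.eventually_ge_atTop 1, hlarge, eventually_ge_atTop 2,
      Real.tendsto_log_atTop.eventually_ge_atTop (1 + x),
      (Real.tendsto_log_atTop.comp Real.tendsto_log_atTop).eventually_ge_atTop 0]
      with t hW hE hy1 hylog hysq hT1 hT2 hT3 hgrow hlarge ht2 htlog htloglog
    intro q _ hqt hq
    have : Fact q.Prime := ⟨hq⟩
    rw [hqt]
    change 0 ≤ Real.log (Real.log t) at htloglog
    set y := α * Real.log t * Real.log (Real.log t) with hydef
    have htpos : 0 < t := by linarith
    have hlog1 : 1 ≤ Real.log t := by linarith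
    have hW' : ((1 - ε) * (σ / (1 - σ)) * α ^ (1 - σ)) *
        (Real.log t ^ (1 - σ) * Real.log (Real.log t) ^ (1 - σ)) ≤
        ∑ p ∈ Nat.primesLE ⌊y⌋₊, ((p : ℝ) ^ (-σ) - y ^ (-σ)) * Real.log p := by
      refine le_trans (le_of_eq ?_) hW
      rw [hydef, Real.mul_rpow (by positivity) htloglog, Real.mul_rpow hα.le (by linarith)]
      ring
    have hWup := LargeValues.sum_rpow_sub_mul_log_le hσ0 hy1
    set W := ∑ p ∈ Nat.primesLE ⌊y⌋₊, ((p : ℝ) ^ (-σ) - y ^ (-σ)) * Real.log p with hWdef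
    set V := c * (Real.log t) ^ (1 - σ) * (Real.log (Real.log t)) ^ (1 - σ) with hVdef
    have hV0 : 0 ≤ V := mul_nonneg (mul_nonneg hc0.le (Real.rpow_nonneg (by linarith) _))
      (Real.rpow_nonneg htloglog _)
    have hWV : V + 1 ≤ W := by
      rw [hVdef]
      linarith
    have hx1 : 1 ≤ t ^ x := Real.one_le_rpow (by linarith) hx.le
    have hlogX : Real.log ⌈t ^ x⌉₊ ≤ Real.log t ^ 2 := by
      have h1 : ((⌈t ^ x⌉₊ : ℕ) : ℝ) ≤ 2 * t ^ x := by
        have := Nat.ceil_lt_add_one (zero_le_one.trans hx1)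
        linarith
      have h2 := Real.log_le_log (by exact_mod_cast Nat.ceil_pos.2 (by linarith)) h1
      rw [Real.log_mul (by norm_num) (by linarith), Real.log_rpow htpos] at h2
      have := Real.log_two_lt_d9
      nlinarith
    have hR : 1 ≤ t ^ x / (2 * y) := by
      rw [le_div_iff₀ (by linarith)]
      linarith [hlarge.1]
    have hη := LargeValues.truncation_le (x := x) (σ' := σ') hlog1 (by linarith) hK0 hy1 hysq
      (by linarith)
    have hlogX0 : 0 ≤ Real.log ⌈t ^ x⌉₊ := Real.log_natCast_nonneg _
    by_contra! hcon
    have key := CharacterCone.resonance_of_upper_bound (q := q) hσ0 hσ1.le hσ'0 hσ'σ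
      (y := y) (R := t ^ x / (2 * y)) (X := ⌈t ^ x⌉₊) (V := V)
      (η := 4 * K * (Real.log t ^ 3 * t ^ (-(x * σ' - 1 / 2))))
      (by rw [hqt]; exact hysq.trans_lt hlarge.2) hR
      (by rw [mul_div_cancel₀ _ (by linarith)]; exact Nat.le_ceil _) hy1 hV0 hT2.le
      (by rw [hqt]; exact hη) (fun χ hχ h0 ↦ (hcon χ hχ h0).le) (by linarith)
    rw [hqt, ← hWdef] at key
    have hmt := LargeValues.main_term_le hσ0 hσ1 (κ := (C + ε) * α) (W := W) ht2 hx
      (hE.trans ((mul_le_mul_of_nonneg_left hylog (by linarith)).trans_eq (by ring)))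
      (by linarith) (by linarith) hlogX
    have hlast : 4 * K * (Real.log t ^ 3 * t ^ (-(x * σ' - 1 / 2))) *
        (6 * W + 6 + Real.log ⌈t ^ x⌉₊ ^ 2) ≤
        76 * K * (Real.log t ^ 7 * t ^ (-(x * σ' - 1 / 2))) := by
      have h1 : 6 * W + 6 + Real.log ⌈t ^ x⌉₊ ^ 2 ≤ 19 * Real.log t ^ 4 := by
        have h2 : Real.log ⌈t ^ x⌉₊ ^ 2 ≤ (Real.log t ^ 2) ^ 2 := pow_le_pow_left₀ hlogX0 hlogX 2
        have h3 : 1 ≤ Real.log t ^ 2 := one_le_pow₀ hlog1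
        have h4 : Real.log t ^ 4 = Real.log t ^ 2 * Real.log t ^ 2 := by ring
        have h5 := mul_le_mul_of_nonneg_left h3 (zero_le_one.trans h3)
        rw [h4]
        linarith
      have h0 : 0 ≤ 4 * K * (Real.log t ^ 3 * t ^ (-(x * σ' - 1 / 2))) :=
        mul_nonneg (by linarith) (by positivity)
      exact (mul_le_mul_of_nonneg_left h1 h0).trans_eq (by ring)
    linarith
  obtain ⟨Q, hQ⟩ := eventually_atTop.1 (tendsto_natCast_atTop_atTop.eventually hmain)
  exact ⟨Q, fun q _ hq hQq ↦ hQ q hQq q rfl hq⟩
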